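/- Let T > 0, r ∈ ℝ, σ > 0, μ₁ > μ₂, κ > 0, and let η : [0,1] → ℝ be either η ≡ 0 or η(p) = −(q₁ + q₂)p + q₂ for some constants q₁, q₂ > 0. Define θ(p) := (μ₁ − μ₂)p + μ₂ and β(p) := ((μ₁ − μ₂)/σ) p(1 − p). Then the degenerate Cauchy problem ∂_t c + ( η(p) − β(p)(θ(p) − r)/σ ) ∂_p c + (β(p)²/2) ∂_{pp} c + κ ((θ(p) − r)/σ)² = 0 on [0,T) × (0,1), with terminal condition c(T, p) = 0 for p ∈ (0,1), admits a solution c that is C^{1,2} on [0,T) × (0,1) and continuous up to the boundary {T} × (0,1); this solution satisfies 0 ≤ c(t,p) ≤ (T − t) κ max( ((μ₁ − r)/σ)², ((μ₂ − r)/σ)² ) for all (t,p) ∈ [0,T] × (0,1), and it is the unique solution in the class of functions that are C^{1,2} on [0,T) × (0,1), continuous up to {T} × (0,1), and bounded on [0,T] × (0,1). -/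

import Mathlib

open Filter Set

/-- The estimated drift `θ(p) = (μ₁ - μ₂) p + μ₂`. -/
noncomputable def filterTheta (μ₁ μ₂ : ℝ) (p : ℝ) : ℝ := (μ₁ - μ₂) * p + μ₂

/-- The filter volatility `β(p) = ((μ₁ - μ₂)/σ) p (1 - p)`. -/
noncomputable def filterBeta (μ₁ μ₂ σ : ℝ) (p : ℝ) : ℝ := (μ₁ - μ₂) / σ * (p * (1 - p))

/-- `c` is a solution, `C^{1,2}` on `[0,T) × (0,1)` and continuous up to the boundary
`{T} × (0,1)`, of the degenerate Cauchy problem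
`∂_t c + (η(p) - β(p)(θ(p) - r)/σ) ∂_p c + (β(p)²/2) ∂_{pp} c + κ ((θ(p) - r)/σ)² = 0`
with terminal condition `c(T, ·) = 0`.  The functions `ct, cp, cpp` witness the
(continuous) partial derivatives `∂_t c`, `∂_p c`, `∂_{pp} c`. -/
def SolvesFirstCauchy (T r σ μ₁ μ₂ κ : ℝ) (η : ℝ → ℝ) (c : ℝ → ℝ → ℝ) : Prop :=
  ∃ ct cp cpp : ℝ → ℝ → ℝ,
    (∀ t ∈ Ico (0 : ℝ) T, ∀ p ∈ Ioo (0 : ℝ) 1,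
      HasDerivWithinAt (fun s => c s p) (ct t p) (Ico (0 : ℝ) T) t ∧
      HasDerivAt (fun q => c t q) (cp t p) p ∧
      HasDerivAt (fun q => cp t q) (cpp t p) p) ∧
    ContinuousOn (fun z : ℝ × ℝ => ct z.1 z.2) (Ico (0 : ℝ) T ×ˢ Ioo (0 : ℝ) 1) ∧
    ContinuousOn (fun z : ℝ × ℝ => cp z.1 z.2) (Ico (0 : ℝ) T ×ˢ Ioo (0 : ℝ) 1) ∧
    ContinuousOn (fun z : ℝ × ℝ => cpp z.1 z.2) (Ico (0 : ℝ) T ×ˢ Ioo (0 : ℝ) 1) ∧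
    ContinuousOn (fun z : ℝ × ℝ => c z.1 z.2) (Icc (0 : ℝ) T ×ˢ Ioo (0 : ℝ) 1) ∧
    (∀ t ∈ Ico (0 : ℝ) T, ∀ p ∈ Ioo (0 : ℝ) 1,
      ct t p
        + (η p - filterBeta μ₁ μ₂ σ p * ((filterTheta μ₁ μ₂ p - r) / σ)) * cp t p
        + filterBeta μ₁ μ₂ σ p ^ 2 / 2 * cpp t p
        + κ * ((filterTheta μ₁ μ₂ p - r) / σ) ^ 2 = 0) ∧
    (∀ p ∈ Ioo (0 : ℝ) 1, c T p = 0)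

/-- `η` is either identically `0` (unknown constant drift) or of the mean-reverting
form `η(p) = -(q₁ + q₂) p + q₂` with `q₁, q₂ > 0` (regime-switching drift). -/
def AdmissibleFilterDrift (η : ℝ → ℝ) : Prop :=
  (∀ p, η p = 0) ∨ ∃ q₁ q₂ : ℝ, 0 < q₁ ∧ 0 < q₂ ∧ ∀ p, η p = -(q₁ + q₂) * p + q₂


section IVP
variable {E : Type*} [NormedAddCommGroup E] [NormedSpace ℝ E] [CompleteSpace E]

noncomputable def picardTerm (M : ℝ → E →L[ℝ] E) (d0 : ℝ → E) : ℕ → ℝ → E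
  | 0 => d0
  | (k + 1) => fun x => ∫ s in (0:ℝ)..x, M s (picardTerm M d0 k s)

lemma picardTerm_continuous (M : ℝ → E →L[ℝ] E) (d0 : ℝ → E) (hM : Continuous M)
    (hd : Continuous d0) (k : ℕ) : Continuous (picardTerm M d0 k) := by
  induction k with
  | zero => exact hd
  | succ k ih =>
    have : Continuous fun s => M s (picardTerm M d0 k s) := hM.clm_apply ih
    exact intervalIntegral.continuous_primitive (fun a b => this.intervalIntegrable a b) 0

lemma picardTerm_bound (M : ℝ → E →L[ℝ] E) (d0 : ℝ → E) (hM : Continuous M)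
    (hd : Continuous d0) (N C D : ℝ) (hC0 : 0 ≤ C) (hC : ∀ x, |x| ≤ N → ‖M x‖ ≤ C)
    (hD : ∀ x, |x| ≤ N → ‖d0 x‖ ≤ D) (k : ℕ) :
    ∀ x, |x| ≤ N → ‖picardTerm M d0 k x‖ ≤ D * (C * |x|) ^ k / (k.factorial : ℝ) := by
  induction k with
  | zero => intro x hx; simpa [picardTerm] using hD x hx
  | succ k ih =>
    intro x hx
    have hIntb : MeasureTheory.IntegrableOn
        (fun s : ℝ => C * (D * C ^ k / (k.factorial : ℝ)) * |s - 0| ^ k) (Set.uIoc 0 x) := by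
      rw [← intervalIntegrable_iff]
      apply Continuous.intervalIntegrable
      fun_prop
    have h1 : ‖∫ s in (0:ℝ)..x, M s (picardTerm M d0 k s)‖ ≤
        ∫ s in Set.uIoc 0 x, C * (D * C ^ k / (k.factorial : ℝ)) * |s - 0| ^ k := by
      rw [intervalIntegral.norm_intervalIntegral_eq]
      refine MeasureTheory.norm_integral_le_of_norm_le hIntb ?_
      refine (MeasureTheory.ae_restrict_mem measurableSet_uIoc).mono ?_
      intro s hs
      have hsx : |s| ≤ |x| := by
        have := Set.abs_sub_left_of_mem_uIcc (Set.uIoc_subset_uIcc hs)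
        simpa using this
      have hsN := hsx.trans hx
      calc ‖M s (picardTerm M d0 k s)‖ ≤ ‖M s‖ * ‖picardTerm M d0 k s‖ := (M s).le_opNorm _
        _ ≤ C * (D * (C * |s|) ^ k / (k.factorial : ℝ)) :=
          mul_le_mul (hC s hsN) (ih s hsN) (norm_nonneg _) hC0
        _ = _ := by rw [sub_zero, mul_pow]; ring
    refine h1.trans (le_of_eq ?_)
    rw [MeasureTheory.integral_const_mul, integral_pow_abs_sub_uIoc, Nat.factorial_succ]
    push_cast
    have : (k.factorial : ℝ) ≠ 0 := by positivity
    have : (k : ℝ) + 1 ≠ 0 := by positivity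
    rw [sub_zero, mul_pow]
    field_simp
    ring

lemma linear_ivp (M : ℝ → E →L[ℝ] E) (h : ℝ → E) (hM : Continuous M) (hh : Continuous h) (y0 : E) :
    ∃ y : ℝ → E, y 0 = y0 ∧ ∀ x, HasDerivAt y (M x (y x) + h x) x := by
  set d0 : ℝ → E := fun x => y0 + ∫ s in (0:ℝ)..x, h s with hd0
  have hd0' : ∀ x, HasDerivAt d0 (h x) x := fun x =>
    ((hh.integral_hasStrictDerivAt 0 x).hasDerivAt).const_add y0
  have hd : Continuous d0 := continuous_iff_continuousAt.2 fun x => (hd0' x).continuousAt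
  set d := picardTerm M d0 with hddef
  have hdc := picardTerm_continuous M d0 hM hd
  have hds : ∀ k x, HasDerivAt (d (k+1)) (M x (d k x)) x := fun k x =>
    ((hM.clm_apply (hdc k)).integral_hasStrictDerivAt 0 x).hasDerivAt
  have hz : ∀ k, d (k+1) 0 = 0 := fun k => by simp [hddef, picardTerm]
  have hbound : ∀ N : ℝ, 0 ≤ N → ∃ C D : ℝ, 0 ≤ C ∧ 0 ≤ D ∧ (∀ x, |x| ≤ N → ‖M x‖ ≤ C) ∧
      ∀ k x, |x| ≤ N → ‖d k x‖ ≤ D * ((C * N) ^ k / (k.factorial : ℝ)) := by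
    intro N hN
    obtain ⟨C, hC⟩ := (isCompact_Icc (a := -N) (b := N)).exists_bound_of_continuousOn hM.continuousOn
    obtain ⟨D, hD⟩ := (isCompact_Icc (a := -N) (b := N)).exists_bound_of_continuousOn hd.continuousOn
    have h0 : (0:ℝ) ∈ Icc (-N) N := ⟨by linarith, hN⟩
    have hC0 : 0 ≤ C := (norm_nonneg _).trans (hC 0 h0)
    have hD0 : 0 ≤ D := (norm_nonneg _).trans (hD 0 h0)
    refine ⟨C, D, hC0, hD0, fun x hx => hC x (abs_le.1 hx), fun k x hx => ?_⟩
    have := picardTerm_bound M d0 hM hd N C D hC0 (fun x hx => hC x (abs_le.1 hx))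
      (fun x hx => hD x (abs_le.1 hx)) k x hx
    refine this.trans ?_
    rw [mul_div_assoc]
    gcongr
  have hsum : ∀ x, Summable fun k => d k x := by
    intro x
    obtain ⟨C, D, hC0, hD0, hC, hb⟩ := hbound |x| (abs_nonneg x)
    exact Summable.of_norm_bounded ((Real.summable_pow_div_factorial (C * |x|)).mul_left D)
      fun k => hb k x le_rfl
  refine ⟨fun x => d0 x + ∑' k, d (k+1) x, ?_, ?_⟩
  · simp [hz, hd0]
  · intro x
    obtain ⟨C, D, hC0, hD0, hC, hb⟩ := hbound (|x| + 1) (by positivity)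
    have key := hasDerivAt_tsum_of_isPreconnected (t := Ioo (-(|x|+1)) (|x|+1))
      (g := fun k => d (k+1)) (g' := fun k x => M x (d k x)) (y₀ := 0) (y := x)
      (u := fun k => C * (D * ((C * (|x|+1)) ^ k / (k.factorial : ℝ))))
      (((Real.summable_pow_div_factorial _).mul_left D).mul_left C) isOpen_Ioo
      isPreconnected_Ioo (fun k y _ => hds k y)
      (fun k y hy => ((M y).le_opNorm _).trans (mul_le_mul (hC y (abs_le.2 ⟨hy.1.le, hy.2.le⟩))
        (hb k y (abs_le.2 ⟨hy.1.le, hy.2.le⟩)) (norm_nonneg _) hC0))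
      ⟨by linarith [abs_nonneg x], by linarith [abs_nonneg x]⟩ (by simp [hz, summable_zero])
      ⟨by linarith [neg_abs_le x], by linarith [le_abs_self x]⟩
    refine ((hd0' x).fun_add key).congr_deriv ?_
    rw [← (M x).map_tsum (hsum x), (hsum x).tsum_eq_zero_add, add_comm]
    rfl
end IVP

lemma scalar_ivp (α h : ℝ → ℝ) (γ : ℝ) (hα : Continuous α) (hh : Continuous h) (y0 y1 : ℝ) :
    ∃ u v : ℝ → ℝ, u 0 = y0 ∧ v 0 = y1 ∧ (∀ x, HasDerivAt u (v x) x) ∧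
      ∀ x, HasDerivAt v (α x * v x + γ * u x + h x) x := by
  let F : ℝ × ℝ →L[ℝ] ℝ := ContinuousLinearMap.fst ℝ ℝ ℝ
  let S : ℝ × ℝ →L[ℝ] ℝ := ContinuousLinearMap.snd ℝ ℝ ℝ
  let M : ℝ → (ℝ × ℝ) →L[ℝ] (ℝ × ℝ) := fun x =>
    (ContinuousLinearMap.inl ℝ ℝ ℝ).comp S + (ContinuousLinearMap.inr ℝ ℝ ℝ).comp (α x • S + γ • F)
  have hM : Continuous M := by
    refine continuous_const.add (continuous_const.clm_comp ?_)
    exact (hα.smul continuous_const).add continuous_const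
  obtain ⟨y, hy0, hy⟩ := linear_ivp M (fun x => (0, h x)) hM (by fun_prop) (y0, y1)
  refine ⟨fun x => (y x).1, fun x => (y x).2, by simp [hy0], by simp [hy0], fun x => ?_, fun x => ?_⟩
  · have := F.hasFDerivAt.comp_hasDerivAt x (hy x)
    refine HasDerivAt.congr_deriv this ?_
    simp [M, F, S]
  · have := S.hasFDerivAt.comp_hasDerivAt x (hy x)
    refine HasDerivAt.congr_deriv this ?_
    simp [M, F, S]


lemma second_deriv_nonpos {u v : ℝ → ℝ} {x w : ℝ}
    (hu : ∀ᶠ y in nhds x, HasDerivAt u (v y) y) (hv : HasDerivAt v w x) (hmax : IsLocalMax u x) :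
    v x = 0 ∧ w ≤ 0 := by
  have hvx : v x = 0 := hmax.hasDerivAt_eq_zero hu.self_of_nhds
  refine ⟨hvx, ?_⟩
  by_contra hw
  push Not at hw
  have hd : deriv u =ᶠ[nhds x] v := hu.mono fun y hy => hy.deriv
  have hdd : deriv (deriv u) x = w := by rw [hd.deriv_eq, hv.deriv]
  have hmin : IsLocalMin u x := isLocalMin_of_deriv_deriv_pos (by rw [hdd]; exact hw)
    (by rw [hd.self_of_nhds, hvx]) hu.self_of_nhds.continuousAt
  have hc : u =ᶠ[nhds x] fun _ => u x := by
    filter_upwards [hmax, hmin] with y h1 h2 using le_antisymm h1 h2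
  have h0 : deriv u =ᶠ[nhds x] fun _ => 0 := by
    filter_upwards [hc.eventuallyEq_nhds] with y hy
    rw [hy.deriv_eq]; simp
  rw [h0.deriv_eq] at hdd
  simp at hdd
  linarith

/-- maximum principle on a compact interval -/
lemma elliptic_compact {A l K a b' : ℝ} (hA : 0 < A) (hl : 0 < l) (hab : a ≤ b') (b u v w : ℝ → ℝ)
    (hu : ∀ x, HasDerivAt u (v x) x) (hv : ∀ x, HasDerivAt v (w x) x)
    (hineq : ∀ x ∈ Icc a b', l * u x - A * w x - b x * v x ≤ K)
    (ha : l * u a ≤ K) (hb : l * u b' ≤ K) : ∀ x ∈ Icc a b', l * u x ≤ K := by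
  have hcont : Continuous u := continuous_iff_continuousAt.2 fun x => (hu x).continuousAt
  obtain ⟨x0, hx0, hmax⟩ := (isCompact_Icc (a := a) (b := b')).exists_isMaxOn
    ⟨a, left_mem_Icc.2 hab⟩ hcont.continuousOn
  intro x hx
  have h1 : u x ≤ u x0 := hmax hx
  have h2 : l * u x0 ≤ K := by
    by_cases h : x0 ∈ Ioo a b'
    · have hloc : IsLocalMax u x0 := hmax.isLocalMax (Icc_mem_nhds h.1 h.2)
      obtain ⟨h3, h4⟩ := second_deriv_nonpos (Eventually.of_forall hu) (hv x0) hloc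
      have := hineq x0 hx0
      rw [h3] at this
      nlinarith
    · have : x0 = a ∨ x0 = b' := by
        by_contra hc
        push Not at hc
        exact h ⟨lt_of_le_of_ne hx0.1 (Ne.symm hc.1), lt_of_le_of_ne hx0.2 hc.2⟩
      rcases this with rfl | rfl <;> assumption
  nlinarith

/-- maximum principle on the line, for functions bounded above -/
lemma elliptic_line {A l K N C : ℝ} (hA : 0 < A) (hl : 0 < l) (b u v w : ℝ → ℝ)
    (hC : ∀ x, 2 * A + 2 * x * b x - l * x ^ 2 ≤ C)
    (hu : ∀ x, HasDerivAt u (v x) x) (hv : ∀ x, HasDerivAt v (w x) x)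
    (hineq : ∀ x, l * u x - A * w x - b x * v x ≤ K)
    (hN : ∀ x, u x ≤ N) : ∀ x, l * u x ≤ K := by
  have hcont : Continuous u := continuous_iff_continuousAt.2 fun x => (hu x).continuousAt
  intro x
  have key : ∀ e : ℝ, 0 < e → l * u x ≤ K + e * (l * x ^ 2 + C) := by
    intro e he
    have hz : Continuous fun y => u y - e * y ^ 2 := by fun_prop
    have hlim : Tendsto (fun y => -(u y - e * y ^ 2)) (cocompact ℝ) atTop := by
      have h1 : Tendsto (fun y : ℝ => e * ‖y‖ ^ 2 - N) (cocompact ℝ) atTop := by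
        apply tendsto_atTop_add_const_right
        apply Tendsto.const_mul_atTop he
        exact (tendsto_pow_atTop (by norm_num)).comp (tendsto_norm_cocompact_atTop)
      refine tendsto_atTop_mono (fun y => ?_) h1
      rw [Real.norm_eq_abs, sq_abs]
      linarith [hN y]
    obtain ⟨x0, hx0⟩ := hz.neg.exists_forall_le hlim
    have hloc : IsLocalMax (fun y => u y - e * y ^ 2) x0 :=
      Eventually.of_forall fun y => by have := hx0 y; simp only [Pi.neg_apply] at this; linarith
    have hd1 : ∀ y, HasDerivAt (fun y => u y - e * y ^ 2) (v y - e * (2 * y)) y := fun y => by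
      have := (hu y).fun_sub (((hasDerivAt_id y).fun_pow 2).const_mul e)
      refine this.congr_deriv ?_
      simp
    have hd2 : HasDerivAt (fun y => v y - e * (2 * y)) (w x0 - e * 2) x0 := by
      have := (hv x0).fun_sub (((hasDerivAt_id x0).const_mul 2).const_mul e)
      refine this.congr_deriv ?_
      simp
    obtain ⟨h3, h4⟩ := second_deriv_nonpos (Eventually.of_forall hd1) hd2 hloc
    have h5 := hineq x0
    have h6 : u x - e * x ^ 2 ≤ u x0 - e * x0 ^ 2 := by
      have := hx0 x; simp only [Pi.neg_apply] at this; linarith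
    have h7 := hC x0
    have h8 : v x0 = e * (2 * x0) := by linarith
    rw [h8] at h5
    have h9 : A * w x0 ≤ A * (e * 2) := by nlinarith
    have h10 : l * (u x - e * x ^ 2) ≤ l * (u x0 - e * x0 ^ 2) := by nlinarith
    have h11 : e * (2 * A + 2 * x0 * b x0 - l * x0 ^ 2) ≤ e * C := by nlinarith
    nlinarith
  by_contra hcon
  push Not at hcon
  set D := |l * x ^ 2 + C| + 1
  have hD : 0 < D := by positivity
  have hD' : l * x ^ 2 + C ≤ D := (le_abs_self _).trans (by simp [D])
  have h1 := key ((l * u x - K) / (2 * D)) (div_pos (by linarith) (by linarith))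
  have h2 : (l * u x - K) / (2 * D) * (l * x ^ 2 + C) ≤ (l * u x - K) / (2 * D) * D :=
    mul_le_mul_of_nonneg_left hD' (div_pos (by linarith) (by linarith)).le
  have h3 : (l * u x - K) / (2 * D) * D = (l * u x - K) / 2 := by field_simp
  linarith

/-- The function `u` (with derivative `v`) solves the resolvent equation. -/
def IsResSol (A : ℝ) (b : ℝ → ℝ) (l : ℝ) (f u v : ℝ → ℝ) : Prop :=
  (∀ x, HasDerivAt u (v x) x) ∧ ∀ x, HasDerivAt v ((l * u x - f x - b x * v x) / A) x

lemma IsResSol.lin {A l : ℝ} {b f u v f' u' v' : ℝ → ℝ} (s t : ℝ)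
    (h : IsResSol A b l f u v) (h' : IsResSol A b l f' u' v') :
    IsResSol A b l (fun x => s * f x + t * f' x) (fun x => s * u x + t * u' x)
      (fun x => s * v x + t * v' x) := by
  refine ⟨fun x => ((h.1 x).const_mul s).fun_add ((h'.1 x).const_mul t), fun x => ?_⟩
  refine (((h.2 x).const_mul s).fun_add ((h'.2 x).const_mul t)).congr_deriv ?_
  ring

lemma IsResSol.bound_compact {A l K a b' : ℝ} {b f u v : ℝ → ℝ} (hA : 0 < A) (hl : 0 < l)
    (hab : a ≤ b') (hK : 0 ≤ K) (hf : ∀ x, |f x| ≤ K) (h : IsResSol A b l f u v)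
    (ha : u a = 0) (hb : u b' = 0) : ∀ x ∈ Icc a b', |u x| ≤ K / l := by
  intro x hx
  have h1 := elliptic_compact hA hl hab b u v _ h.1 h.2 (K := K) (fun y _ => by
    have := (abs_le.1 (hf y)).2
    have e : A * ((l * u y - f y - b y * v y) / A) = (l * u y - f y - b y * v y) := by field_simp
    rw [e]; linarith) (by simp [ha, hK]) (by simp [hb, hK]) x hx
  have h2 := elliptic_compact hA hl hab b (fun x => - u x) (fun x => - v x) _
    (fun y => (h.1 y).fun_neg) (fun y => (h.2 y).fun_neg) (K := K) (fun y _ => by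
    have := (abs_le.1 (hf y)).1
    have e : A * -((l * u y - f y - b y * v y) / A) = -(l * u y - f y - b y * v y) := by field_simp
    rw [e]; linarith) (by simp [ha, hK]) (by simp [hb, hK]) x hx
  rw [abs_le, ← neg_div, div_le_iff₀ hl, le_div_iff₀ hl]
  constructor <;> linarith

lemma IsResSol.bound_line {A l K C N : ℝ} {b f u v : ℝ → ℝ} (hA : 0 < A) (hl : 0 < l)
    (hC : ∀ x, 2 * A + 2 * x * b x - l * x ^ 2 ≤ C)
    (hf : ∀ x, |f x| ≤ K) (h : IsResSol A b l f u v) (hN : ∀ x, |u x| ≤ N) :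
    ∀ x, |u x| ≤ K / l := by
  intro x
  have h1 := elliptic_line hA hl b u v _ hC h.1 h.2 (K := K) (fun y => by
    have := (abs_le.1 (hf y)).2
    have e : A * ((l * u y - f y - b y * v y) / A) = (l * u y - f y - b y * v y) := by field_simp
    rw [e]; linarith) (fun y => (abs_le.1 (hN y)).2) x
  have h2 := elliptic_line hA hl b (fun x => - u x) (fun x => - v x) _ hC
    (fun y => (h.1 y).fun_neg) (fun y => (h.2 y).fun_neg) (K := K) (fun y => by
    have := (abs_le.1 (hf y)).1
    have e : A * -((l * u y - f y - b y * v y) / A) = -(l * u y - f y - b y * v y) := by field_simp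
    rw [e]; linarith) (N := N) (fun y => by linarith [(abs_le.1 (hN y)).1]) x
  rw [abs_le, ← neg_div, div_le_iff₀ hl, le_div_iff₀ hl]
  constructor <;> linarith

lemma exists_ivp {A l : ℝ} {b f : ℝ → ℝ} (hA : 0 < A) (hb : Continuous b) (hf : Continuous f)
    (y0 y1 : ℝ) : ∃ u v, IsResSol A b l f u v ∧ u 0 = y0 ∧ v 0 = y1 := by
  obtain ⟨u, v, h0, h1, h2, h3⟩ := scalar_ivp (fun x => - b x / A) (fun x => - f x / A) (l / A)
    (by fun_prop) (by fun_prop) y0 y1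
  refine ⟨u, v, ⟨h2, fun x => (h3 x).congr_deriv ?_⟩, h0, h1⟩
  field_simp
  ring

lemma IsResSol.zero_of_dirichlet {A l a b' : ℝ} {b u v : ℝ → ℝ} (hA : 0 < A) (hl : 0 < l)
    (hab : a < b') (h : IsResSol A b l (fun _ => 0) u v)
    (ha : u a = 0) (hb : u b' = 0) (h0 : (0:ℝ) ∈ Icc a b') : u 0 = 0 ∧ v 0 = 0 := by
  have hz : ∀ x ∈ Icc a b', u x = 0 := by
    intro x hx
    have := h.bound_compact hA hl hab.le le_rfl (fun x => by simp) ha hb x hx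
    simpa using this
  refine ⟨hz 0 h0, ?_⟩
  have hu := (h.1 0).hasDerivWithinAt (s := Icc a b')
  have h2 : HasDerivWithinAt u 0 (Icc a b') 0 :=
    (hasDerivWithinAt_const 0 (Icc a b') (0:ℝ)).congr hz (hz 0 h0)
  exact (uniqueDiffOn_Icc hab 0 h0).eq_deriv _ hu h2

lemma exists_resolvent {A l K : ℝ} {b f : ℝ → ℝ} (hA : 0 < A) (hl : 0 < l)
    (hb : Continuous b) (hf : Continuous f) (hK : 0 ≤ K) (hfK : ∀ x, |f x| ≤ K) :
    ∃ u v, IsResSol A b l f u v ∧ ∀ x, |u x| ≤ K / l := by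
  obtain ⟨U, U', hU, -, -⟩ := exists_ivp (l := l) hA hb hf 0 0
  obtain ⟨φ, φ', hφ, hφ0, hφ1⟩ := exists_ivp (l := l) hA hb (continuous_const (y := (0:ℝ))) 1 0
  obtain ⟨ψ, ψ', hψ, hψ0, hψ1⟩ := exists_ivp (l := l) hA hb (continuous_const (y := (0:ℝ))) 0 1
  have hcomb : ∀ s t : ℝ, IsResSol A b l f (fun x => U x + (s * φ x + t * ψ x))
      (fun x => U' x + (s * φ' x + t * ψ' x)) := by
    intro s t
    have := hU.lin 1 1 (hφ.lin s t hψ)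
    simpa using this
  have hpsine : ψ 1 ≠ 0 := by
    intro h1
    have := (hψ.zero_of_dirichlet hA hl one_pos hψ0 h1 ⟨le_rfl, zero_le_one⟩).2
    rw [hψ1] at this
    exact one_ne_zero this
  -- Dirichlet problems
  have hdir : ∀ n : ℕ, ∃ s t : ℝ, ∀ x ∈ Icc (-((n:ℝ) + 1)) ((n:ℝ) + 1),
      |U x + (s * φ x + t * ψ x)| ≤ K / l := by
    intro n
    set r : ℝ := (n:ℝ) + 1 with hr
    have hr0 : 0 < r := by positivity
    let Lm : ℝ × ℝ →ₗ[ℝ] ℝ × ℝ :=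
      { toFun := fun z => (z.1 * φ (-r) + z.2 * ψ (-r), z.1 * φ r + z.2 * ψ r)
        map_add' := by intro x y; ext <;> simp <;> ring
        map_smul' := by intro c x; ext <;> simp <;> ring }
    have hinj : Function.Injective Lm := by
      rw [← LinearMap.ker_eq_bot, LinearMap.ker_eq_bot']
      rintro ⟨s, t⟩ hst
      have h1 : s * φ (-r) + t * ψ (-r) = 0 := congrArg Prod.fst hst
      have h2 : s * φ r + t * ψ r = 0 := congrArg Prod.snd hst
      have hs : IsResSol A b l (fun _ => 0) (fun x => s * φ x + t * ψ x)
          (fun x => s * φ' x + t * ψ' x) := by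
        have := hφ.lin s t hψ
        simpa using this
      obtain ⟨h3, h4⟩ := hs.zero_of_dirichlet hA hl (by linarith : -r < r) h1 h2
        ⟨by linarith, hr0.le⟩
      simp only [hφ0, hψ0, hφ1, hψ1] at h3 h4
      ext <;> simp <;> linarith
    obtain ⟨⟨s, t⟩, hst⟩ := (LinearMap.injective_iff_surjective.1 hinj) (-U (-r), -U r)
    have h1 : s * φ (-r) + t * ψ (-r) = -U (-r) := congrArg Prod.fst hst
    have h2 : s * φ r + t * ψ r = -U r := congrArg Prod.snd hst
    exact ⟨s, t, (hcomb s t).bound_compact hA hl (by linarith) hK hfK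
      (by simp only [h1]; ring) (by simp only [h2]; ring)⟩
  choose s t hst using hdir
  -- boundedness of the coefficients
  have hn1 : ∀ n : ℕ, (0:ℝ) ≤ n := fun n => n.cast_nonneg
  have hs : ∀ n, |s n| ≤ K / l + |U 0| := by
    intro n
    have := hst n 0 ⟨by linarith [hn1 n], by linarith [hn1 n]⟩
    rw [hφ0, hψ0] at this
    have h2 : s n = (U 0 + (s n * 1 + t n * 0)) - U 0 := by ring
    rw [h2]
    exact (abs_sub _ _).trans (by linarith)
  have ht : ∀ n, |t n| ≤ (K / l + |U 1| + (K / l + |U 0|) * |φ 1|) / |ψ 1| := by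
    intro n
    have := hst n 1 ⟨by linarith [hn1 n], by linarith [hn1 n]⟩
    rw [le_div_iff₀ (abs_pos.2 hpsine), ← abs_mul]
    have h2 : t n * ψ 1 = (U 1 + (s n * φ 1 + t n * ψ 1)) - U 1 - s n * φ 1 := by ring
    rw [h2]
    refine (abs_sub _ _).trans (add_le_add ((abs_sub _ _).trans (by linarith)) ?_)
    rw [abs_mul]
    exact mul_le_mul_of_nonneg_right (hs n) (abs_nonneg _)
  obtain ⟨⟨s0, t0⟩, -, g, hg, hlim⟩ := (isCompact_Icc.prod isCompact_Icc).tendsto_subseq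
    (x := fun n => (s n, t n)) (fun n => Set.mk_mem_prod (abs_le.1 (hs n)) (abs_le.1 (ht n)))
  refine ⟨_, _, hcomb s0 t0, fun x => ?_⟩
  have hl1 : Tendsto (fun n => s (g n)) atTop (nhds s0) := (continuous_fst.tendsto _).comp hlim
  have hl2 : Tendsto (fun n => t (g n)) atTop (nhds t0) := (continuous_snd.tendsto _).comp hlim
  have hl3 : Tendsto (fun n => |U x + (s (g n) * φ x + t (g n) * ψ x)|) atTop
      (nhds |U x + (s0 * φ x + t0 * ψ x)|) :=
    (tendsto_const_nhds.add ((hl1.mul_const _).add (hl2.mul_const _))).abs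
  refine le_of_tendsto hl3 ?_
  obtain ⟨N, hN⟩ := exists_nat_ge |x|
  filter_upwards [eventually_ge_atTop N] with n hn
  have h1 : N ≤ g n := hn.trans (hg.id_le n)
  have h2 : (N:ℝ) ≤ (g n : ℝ) := by exact_mod_cast h1
  exact hst (g n) x (abs_le.1 (by linarith))


section HY
variable {X : Type*} [NormedAddCommGroup X] [NormedSpace ℝ X] [CompleteSpace X]

lemma dissip_bound (R : X →L[ℝ] X) (n : ℝ) (hn : 0 < n) (hR : ‖R‖ ≤ 1 / n) (w z : ℝ → X) (e : ℝ)
    (hw : ∀ t, HasDerivAt w (n ^ 2 • R (w t) - n • w t + z t) t)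
    (hz : ∀ t, 0 ≤ t → ‖z t‖ ≤ e) (t : ℝ) (ht : 0 ≤ t) : ‖w t‖ ≤ ‖w 0‖ + t * e := by
  have hy : ∀ s, HasDerivAt (fun s => Real.exp (n * s) • w s)
      (Real.exp (n * s) • (n ^ 2 • R (w s) + z s)) s := by
    intro s
    have h1 : HasDerivAt (fun s => Real.exp (n * s)) (Real.exp (n * s) * n) s := by
      simpa using ((hasDerivAt_id s).const_mul n).exp
    refine (h1.smul (hw s)).congr_deriv ?_
    module
  have key : ∀ e' : ℝ, e < e' → ‖w t‖ ≤ ‖w 0‖ + t * e' := by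
    intro e' he'
    have hB : ∀ s, HasDerivAt (fun s => Real.exp (n * s) * (‖w 0‖ + s * e'))
        (Real.exp (n * s) * (n * (‖w 0‖ + s * e') + e')) s := by
      intro s
      have h1 : HasDerivAt (fun s => Real.exp (n * s)) (Real.exp (n * s) * n) s := by
        simpa using ((hasDerivAt_id s).const_mul n).exp
      refine (h1.fun_mul (((hasDerivAt_id s).mul_const e').const_add ‖w 0‖)).congr_deriv ?_
      simp
      ring
    have := image_norm_le_of_norm_deriv_right_lt_deriv_boundary' (a := 0) (b := t)
      (f := fun s => Real.exp (n * s) • w s)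
      (f' := fun s => Real.exp (n * s) • (n ^ 2 • R (w s) + z s))
      (fun s _ => (hy s).continuousAt.continuousWithinAt) (fun s _ => (hy s).hasDerivWithinAt)
      (B := fun s => Real.exp (n * s) * (‖w 0‖ + s * e'))
      (B' := fun s => Real.exp (n * s) * (n * (‖w 0‖ + s * e') + e'))
      (by simp) (fun s _ => (hB s).continuousAt.continuousWithinAt)
      (fun s _ => (hB s).hasDerivWithinAt) ?_ (right_mem_Icc.2 ht)
    · rw [norm_smul, Real.norm_eq_abs, abs_of_pos (Real.exp_pos _)] at this
      exact le_of_mul_le_mul_left this (Real.exp_pos _)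
    · intro s hs heq
      rw [norm_smul, Real.norm_eq_abs, abs_of_pos (Real.exp_pos _)] at heq ⊢
      have heq' := mul_left_cancel₀ (Real.exp_pos _).ne' heq
      apply mul_lt_mul_of_pos_left _ (Real.exp_pos _)
      have h1 : ‖n ^ 2 • R (w s)‖ ≤ n * ‖w s‖ := by
        rw [norm_smul, Real.norm_eq_abs, abs_of_pos (by positivity)]
        have := (R.le_opNorm (w s)).trans (mul_le_mul_of_nonneg_right hR (norm_nonneg _))
        calc n ^ 2 * ‖R (w s)‖ ≤ n ^ 2 * (1 / n * ‖w s‖) := by gcongr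
          _ = n * ‖w s‖ := by field_simp
      rw [← heq']
      have := hz s hs.1
      linarith [norm_add_le (n ^ 2 • R (w s)) (z s)]
  by_contra hcon
  push Not at hcon
  rcases ht.eq_or_lt with rfl | ht0
  · simp at hcon
  · have := key (e + (‖w t‖ - (‖w 0‖ + t * e)) / (2 * t)) (by
      have : 0 < (‖w t‖ - (‖w 0‖ + t * e)) / (2 * t) := div_pos (by linarith) (by linarith)
      linarith)
    have h2 : t * (e + (‖w t‖ - (‖w 0‖ + t * e)) / (2 * t)) =
      t * e + (‖w t‖ - (‖w 0‖ + t * e)) / 2 := by field_simp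
    rw [h2] at this
    linarith

/-- Yosida approximation -/
noncomputable def yos (R : ℝ → X →L[ℝ] X) (n : ℝ) : X →L[ℝ] X := n ^ 2 • R n - n • 1

lemma yos_apply (R : ℝ → X →L[ℝ] X) (n : ℝ) (f : X) : yos R n f = n ^ 2 • R n f - n • f := by
  simp [yos]

theorem hille_yosida (R : ℝ → X →L[ℝ] X) (hR : ∀ l, 0 < l → ‖R l‖ ≤ 1 / l)
    (hres : ∀ l m, 0 < l → 0 < m → ∀ f, R m (f + (m - l) • R l f) = R l f) (g g1 g2 : X)
    (h1 : ∀ n, 0 < n → R n (n • g - g1) = g) (h2 : ∀ n, 0 < n → R n (n • g1 - g2) = g1) :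
    ∃ S : ℝ → X, Continuous S ∧
      ∀ τ, 0 ≤ τ → R 1 ((∫ s in (0:ℝ)..τ, S s) - S τ + g) = ∫ s in (0:ℝ)..τ, S s := by
  have hcomm : ∀ l m, 0 < l → 0 < m → ∀ f, R m (R l f) = R l (R m f) := by
    intro l m hl hm f
    rcases eq_or_ne l m with rfl | hne
    · rfl
    have e1 := hres l m hl hm f
    have e2 := hres m l hm hl f
    simp only [map_add, map_smul] at e1 e2
    have e3 : (m - l) • (R m (R l f) - R l (R m f)) = 0 := by
      have : (m - l) • (R m (R l f) - R l (R m f)) =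
        (R m f + (m - l) • R m (R l f)) + (R l f + (l - m) • R l (R m f)) - R m f - R l f := by module
      rw [this, e1, e2]; abel
    rcases smul_eq_zero.1 e3 with h | h
    · exact absurd (sub_eq_zero.1 h).symm hne
    · exact sub_eq_zero.1 h
  have hBcomm : ∀ l m, 0 < l → 0 < m → ∀ f, yos R m (yos R l f) = yos R l (yos R m f) := by
    intro l m hl hm f
    simp only [yos_apply, map_sub, map_smul, hcomm l m hl hm f]
    module
  have hBg : ∀ n, 0 < n → yos R n g = n • R n g1 := by
    intro n hn
    have e := h1 n hn
    rw [map_sub, map_smul] at e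
    rw [yos_apply]
    have : n ^ 2 • R n g - n • g = n • (n • R n g - R n g1 - g) + n • R n g1 := by module
    rw [this, e]; simp
  have hBg1 : ∀ n, 0 < n → ‖yos R n g - g1‖ ≤ ‖g2‖ / n := by
    intro n hn
    have e := h2 n hn
    rw [map_sub, map_smul] at e
    have : yos R n g - g1 = R n g2 := by
      rw [hBg n hn]
      nth_rewrite 2 [← e]
      abel
    rw [this]
    refine ((R n).le_opNorm _).trans ?_
    refine (mul_le_mul_of_nonneg_right (hR n hn) (norm_nonneg _)).trans (le_of_eq ?_)
    ring
  have hsol : ∀ n : ℝ, ∃ u : ℝ → X, u 0 = g ∧ ∀ t, HasDerivAt u (yos R n (u t)) t := by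
    intro n
    obtain ⟨u, hu0, hu⟩ := linear_ivp (fun _ => yos R n) (fun _ => (0:X)) continuous_const
      continuous_const g
    exact ⟨u, hu0, fun t => by simpa using hu t⟩
  choose u hu0 hu using hsol
  have hcontr : ∀ n, 0 < n → ∀ w : ℝ → X, (∀ t, HasDerivAt w (yos R n (w t)) t) →
      ∀ t, 0 ≤ t → ‖w t‖ ≤ ‖w 0‖ := by
    intro n hn w hw t ht
    have := dissip_bound (R n) n hn (hR n hn) w (fun _ => 0) 0
      (fun t => by simpa [yos_apply] using hw t) (by simp) t ht
    simpa using this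
  have hdiff : ∀ n m, 0 < n → 0 < m → ∀ t, 0 ≤ t →
      ‖u n t - u m t‖ ≤ t * (‖g2‖ / n + ‖g2‖ / m) := by
    intro n m hn hm t ht
    have hz : ∀ s, 0 ≤ s → ‖(yos R n - yos R m) (u m s)‖ ≤ ‖g2‖ / n + ‖g2‖ / m := by
      intro s hs
      refine (hcontr m hm (fun s => (yos R n - yos R m) (u m s)) (fun s => ?_) s hs).trans ?_
      · refine ((yos R n - yos R m).hasFDerivAt.comp_hasDerivAt s (hu m s)).congr_deriv ?_
        simp only [sub_apply, map_sub]
        rw [hBcomm m n hm hn]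
      · simp only [hu0, sub_apply]
        have : yos R n g - yos R m g = (yos R n g - g1) - (yos R m g - g1) := by abel
        rw [this]
        exact (norm_sub_le _ _).trans (add_le_add (hBg1 n hn) (hBg1 m hm))
    have := dissip_bound (R n) n hn (hR n hn) (fun s => u n s - u m s)
      (fun s => (yos R n - yos R m) (u m s)) _ (fun s => ?_) hz t ht
    · simpa [hu0] using this
    · refine ((hu n s).sub (hu m s)).congr_deriv ?_
      simp only [sub_apply, map_sub, yos_apply]
      module
  -- the sequence
  let N : ℕ → ℝ := fun k => (k:ℝ) + 1
  have hN : ∀ k, 0 < N k := fun k => by positivity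
  have hNlim : ∀ a : ℝ, Tendsto (fun k => a / N k) atTop (nhds 0) := fun a =>
    tendsto_const_nhds.div_atTop (tendsto_atTop_add_const_right _ _ tendsto_natCast_atTop_atTop)
  let U : ℕ → ℝ → X := fun k t => u (N k) (max t 0)
  have hucont : ∀ n, Continuous (u n) := fun n =>
    continuous_iff_continuousAt.2 fun t => (hu n t).continuousAt
  have hUc : ∀ k, Continuous (U k) := fun k => (hucont _).comp (by fun_prop)
  have hcau : ∀ t, ∃ x, Tendsto (fun k => U k t) atTop (nhds x) := by
    intro t
    apply cauchySeq_tendsto_of_complete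
    refine cauchySeq_of_le_tendsto_0 (fun k => max t 0 * (2 * ‖g2‖ / N k)) ?_ ?_
    · intro n m k hn hm
      rw [dist_eq_norm]
      refine (hdiff _ _ (hN n) (hN m) _ (le_max_right _ _)).trans ?_
      have a1 : N k ≤ N n := by simp only [N]; gcongr
      have a2 : N k ≤ N m := by simp only [N]; gcongr
      have : ‖g2‖ / N n + ‖g2‖ / N m ≤ ‖g2‖ / N k + ‖g2‖ / N k := by
        have := hN k
        gcongr
      refine (mul_le_mul_of_nonneg_left this (le_max_right _ _)).trans (le_of_eq ?_)
      ring
    · simpa using (hNlim (2 * ‖g2‖)).const_mul (max t 0)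
  choose S hS using hcau
  have hSb : ∀ k t, ‖U k t - S t‖ ≤ max t 0 * (‖g2‖ / N k) := by
    intro k t
    have l1 : Tendsto (fun m => ‖U k t - U m t‖) atTop (nhds ‖U k t - S t‖) :=
      (tendsto_const_nhds.sub (hS t)).norm
    have l2 : Tendsto (fun m => max t 0 * (‖g2‖ / N k + ‖g2‖ / N m)) atTop
        (nhds (max t 0 * (‖g2‖ / N k + 0))) := (tendsto_const_nhds.add (hNlim _)).const_mul _
    rw [add_zero] at l2
    exact le_of_tendsto_of_tendsto' l1 l2 fun m => hdiff _ _ (hN k) (hN m) _ (le_max_right _ _)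
  have hScont : Continuous S := by
    have : TendstoLocallyUniformly U S atTop := by
      rw [Metric.tendstoLocallyUniformly_iff]
      intro e he x
      refine ⟨Metric.ball x 1, Metric.ball_mem_nhds x one_pos, ?_⟩
      have := (hNlim ((|x| + 1) * ‖g2‖)).eventually (gt_mem_nhds he)
      filter_upwards [this] with k hk y hy
      rw [dist_comm, dist_eq_norm]
      refine (hSb k y).trans_lt (lt_of_le_of_lt ?_ hk)
      rw [mul_div_assoc]
      have hg : 0 ≤ ‖g2‖ / N k := div_nonneg (norm_nonneg _) (hN k).le
      refine mul_le_mul_of_nonneg_right (max_le ?_ (by positivity)) hg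
      rw [Metric.mem_ball, Real.dist_eq] at hy
      have := abs_lt.1 hy
      linarith [le_abs_self x]
    exact this.continuous (Frequently.of_forall hUc)
  refine ⟨S, hScont, fun τ hτ => ?_⟩
  set c : ℕ → X := fun k => ∫ s in (0:ℝ)..τ, U k s with hc
  have hclim : Tendsto c atTop (nhds (∫ s in (0:ℝ)..τ, S s)) := by
    rw [tendsto_iff_norm_sub_tendsto_zero]
    refine squeeze_zero (fun _ => norm_nonneg _) (g := fun k => τ * ‖g2‖ * τ / N k) (fun k => ?_)
      (hNlim _)
    rw [hc, ← intervalIntegral.integral_sub ((hUc k).intervalIntegrable _ _)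
      (hScont.intervalIntegrable _ _)]
    refine (intervalIntegral.norm_integral_le_of_norm_le_const (C := τ * (‖g2‖ / N k)) ?_).trans
      (le_of_eq ?_)
    · intro s hs
      rw [uIoc_of_le hτ] at hs
      refine (hSb k s).trans (mul_le_mul_of_nonneg_right (max_le hs.2 hτ)
        (div_nonneg (norm_nonneg _) (hN k).le))
    · rw [sub_zero, abs_of_nonneg hτ]; ring
  have hBc : ∀ k, yos R (N k) (c k) = U k τ - g := by
    intro k
    have e1 : c k = ∫ s in (0:ℝ)..τ, u (N k) s := by
      apply intervalIntegral.integral_congr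
      intro s hs
      rw [uIcc_of_le hτ] at hs
      simp only [U, max_eq_left hs.1]
    rw [e1, ← ContinuousLinearMap.intervalIntegral_comp_comm _ ((hucont _).intervalIntegrable _ _),
      intervalIntegral.integral_eq_sub_of_hasDerivAt (fun s _ => hu (N k) s)
        (((yos R (N k)).continuous.comp (hucont _)).intervalIntegrable _ _), hu0]
    simp only [U, max_eq_left hτ]
  have hid : ∀ n, 0 < n → ∀ f, R 1 (yos R n f) =
      R 1 f - f + (1 / n) • (R 1 (yos R n f) - yos R n f) := by
    intro n hn f
    have e := hres 1 n one_pos hn f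
    rw [map_add, map_smul] at e
    simp only [yos_apply, map_sub, map_smul, hcomm n 1 hn one_pos]
    have hn' : n ≠ 0 := hn.ne'
    have e2 : R 1 f = R n f + (n - 1) • R n (R 1 f) := e.symm
    set a := R n (R 1 f)
    rw [e2]
    have e3 : (1 / n) • (n ^ 2 • a - n • (R n f + (n - 1) • a) - (n ^ 2 • R n f - n • f)) =
      (n • a - (R n f + (n - 1) • a) - (n • R n f - f)) := by
      match_scalars <;> field_simp
    rw [e3]
    module
  have hlim1 : Tendsto (fun k => R 1 (U k τ - g)) atTop (nhds (R 1 (S τ - g))) :=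
    ((R 1).continuous.tendsto _).comp ((hS τ).sub_const g)
  have hlim2 : Tendsto (fun k => R 1 (c k) - c k + (1 / N k) • (R 1 (U k τ - g) - (U k τ - g)))
      atTop (nhds (R 1 (∫ s in (0:ℝ)..τ, S s) - (∫ s in (0:ℝ)..τ, S s) +
        (0:ℝ) • (R 1 (S τ - g) - (S τ - g)))) :=
    ((((R 1).continuous.tendsto _).comp hclim).sub hclim).add
      ((hNlim 1).smul (hlim1.sub ((hS τ).sub_const g)))
  have heq : (fun k => R 1 (U k τ - g)) =
      fun k => R 1 (c k) - c k + (1 / N k) • (R 1 (U k τ - g) - (U k τ - g)) := by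
    funext k
    have := hid (N k) (hN k) (c k)
    rwa [hBc k] at this
  rw [heq] at hlim1
  have := tendsto_nhds_unique hlim1 hlim2
  rw [zero_smul, add_zero] at this
  have e : (∫ s in (0:ℝ)..τ, S s) - S τ + g = (∫ s in (0:ℝ)..τ, S s) - (S τ - g) := by abel
  rw [e, map_sub, this]
  abel
end HY


lemma exists_resolvent_op {A : ℝ} {b : ℝ → ℝ} (hA : 0 < A) (hb : Continuous b)
    (hC : ∀ l, 0 < l → ∃ C, ∀ x, 2 * A + 2 * x * b x - l * x ^ 2 ≤ C) :
    ∃ R : ℝ → BoundedContinuousFunction ℝ ℝ →L[ℝ] BoundedContinuousFunction ℝ ℝ,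
      ∀ l, 0 < l → ‖R l‖ ≤ 1 / l ∧ ∀ f u : BoundedContinuousFunction ℝ ℝ, (∃ v, IsResSol A b l f u v) ↔ R l f = u := by
  have main : ∀ l : ℝ, ∃ Rl : BoundedContinuousFunction ℝ ℝ →L[ℝ] BoundedContinuousFunction ℝ ℝ,
      0 < l → ‖Rl‖ ≤ 1 / l ∧ ∀ f u : BoundedContinuousFunction ℝ ℝ, (∃ v, IsResSol A b l f u v) ↔ Rl f = u := by
    intro l
    by_cases hl : 0 < l
    swap
    · exact ⟨0, fun h => absurd h hl⟩
    obtain ⟨C, hC⟩ := hC l hl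
    have huniq : ∀ (f u u' : BoundedContinuousFunction ℝ ℝ), (∃ v, IsResSol A b l f u v) →
        (∃ v, IsResSol A b l f u' v) → u = u' := by
      rintro f u u' ⟨v, hv⟩ ⟨v', hv'⟩
      have h := hv.lin 1 (-1) hv'
      ext x
      have := h.bound_line (K := 0) hA hl hC (fun x => by simp) (N := ‖u - u'‖) (fun x => by
        have := (u - u').norm_coe_le_norm x
        rw [Real.norm_eq_abs] at this
        convert this using 2
        simp; ring) x
      rw [zero_div] at this
      have h0 := abs_nonpos_iff.1 this
      linarith
    have hex : ∀ f : BoundedContinuousFunction ℝ ℝ, ∃ u : BoundedContinuousFunction ℝ ℝ,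
        (∃ v, IsResSol A b l f u v) ∧ ‖u‖ ≤ 1 / l * ‖f‖ := by
      intro f
      obtain ⟨u, v, huv, hbd⟩ := exists_resolvent hA hl hb f.continuous (norm_nonneg f)
        (fun x => f.norm_coe_le_norm x)
      have hcu : Continuous u := continuous_iff_continuousAt.2 fun x => (huv.1 x).continuousAt
      refine ⟨BoundedContinuousFunction.ofNormedAddCommGroup u hcu (‖f‖ / l) hbd, ⟨v, huv⟩, ?_⟩
      refine (BoundedContinuousFunction.norm_ofNormedAddCommGroup_le _
        (div_nonneg (norm_nonneg _) hl.le) _).trans (le_of_eq ?_)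
      ring
    choose r hr hrn using hex
    let Rm : BoundedContinuousFunction ℝ ℝ →ₗ[ℝ] BoundedContinuousFunction ℝ ℝ :=
      { toFun := r
        map_add' := by
          intro f f'
          obtain ⟨v, hv⟩ := hr f
          obtain ⟨v', hv'⟩ := hr f'
          refine huniq _ _ _ (hr _) ⟨fun x => v x + v' x, ?_⟩
          have := hv.lin 1 1 hv'
          simp only [one_mul] at this
          exact this
        map_smul' := by
          intro s f
          obtain ⟨v, hv⟩ := hr f
          refine huniq _ _ _ (hr _) ⟨fun x => s * v x, ?_⟩
          simpa using hv.lin s 0 hv }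
    refine ⟨Rm.mkContinuous (1 / l) hrn, fun _ => ⟨?_, ?_⟩⟩
    · exact Rm.mkContinuous_norm_le (by positivity) _
    · intro f u
      constructor
      · intro h
        exact huniq f _ _ (hr f) h
      · rintro rfl
        exact hr f
  choose R hR using main
  exact ⟨R, hR⟩

lemma gradient_bound {A : ℝ} {b : ℝ → ℝ} (hA : 0 < A) (hb : Continuous b) (N : ℝ) :
    ∃ C, 0 ≤ C ∧ ∀ (f u v : ℝ → ℝ) (K : ℝ), IsResSol A b 1 f u v → (∀ x, |f x| ≤ K) →
      (∀ x, |u x| ≤ K) → ∀ x, |x| ≤ N → |v x| ≤ C * K := by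
  set B : ℝ → ℝ := fun x => ∫ s in (0:ℝ)..x, b s / A with hBdef
  have hB : ∀ x, HasDerivAt B (b x / A) x := fun x =>
    ((by fun_prop : Continuous fun s => b s / A).integral_hasStrictDerivAt 0 x).hasDerivAt
  have hBc : Continuous B := continuous_iff_continuousAt.2 fun x => (hB x).continuousAt
  obtain ⟨M, hM⟩ := (isCompact_Icc (a := -N) (b := N + 1)).exists_bound_of_continuousOn
    hBc.continuousOn
  refine ⟨Real.exp M * (2 * Real.exp M + 2 * Real.exp M / A), by positivity, ?_⟩
  intro f u v K h hf hu x hx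
  obtain ⟨hx1, hx2⟩ := abs_le.1 hx
  have hK : 0 ≤ K := (abs_nonneg _).trans (hu 0)
  have hP : ∀ y, HasDerivAt (fun y => v y * Real.exp (B y)) (Real.exp (B y) * ((u y - f y) / A)) y := by
    intro y
    refine ((h.2 y).fun_mul (hB y).exp).congr_deriv ?_
    field_simp
    ring
  obtain ⟨ξ, hξ, hξe⟩ := exists_hasDerivAt_eq_slope u v (by linarith : x < x + 1)
    (fun y _ => (h.1 y).continuousAt.continuousWithinAt) (fun y _ => h.1 y)
  have hvξ : |v ξ| ≤ 2 * K := by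
    rw [hξe]
    have : x + 1 - x = 1 := by ring
    rw [this, div_one]
    exact (abs_sub _ _).trans (by linarith [hu x, hu (x+1)])
  have hBle : ∀ y ∈ Icc (-N) (N+1), Real.exp (B y) ≤ Real.exp M := fun y hy =>
    Real.exp_le_exp.2 ((le_abs_self _).trans (hM y hy))
  have hsub : ∀ y ∈ Icc x (x+1), y ∈ Icc (-N) (N+1) := fun y hy =>
    ⟨by linarith [hy.1], by linarith [hy.2]⟩
  have hdiff := (convex_Icc x (x+1)).norm_image_sub_le_of_norm_hasDerivWithin_le
    (f := fun y => v y * Real.exp (B y)) (f' := fun y => Real.exp (B y) * ((u y - f y) / A))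
    (C := Real.exp M * (2 * K / A))
    (fun y _ => (hP y).hasDerivWithinAt) (fun y hy => by
      rw [norm_mul, Real.norm_eq_abs, Real.norm_eq_abs, abs_of_pos (Real.exp_pos _), abs_div,
        abs_of_pos hA]
      have : |u y - f y| ≤ 2 * K := (abs_sub _ _).trans (by linarith [hu y, hf y])
      have := hBle y (hsub y hy)
      gcongr)
    (Ioo_subset_Icc_self hξ) (left_mem_Icc.2 (by linarith))
  simp only [Real.norm_eq_abs] at hdiff
  have hxi : |x - ξ| ≤ 1 := by
    rw [abs_le]; constructor <;> linarith [hξ.1, hξ.2]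
  have h1 : |v x * Real.exp (B x)| ≤ Real.exp M * (2 * K / A) + 2 * K * Real.exp M := by
    have e : v x * Real.exp (B x) = (v x * Real.exp (B x) - v ξ * Real.exp (B ξ)) +
      v ξ * Real.exp (B ξ) := by ring
    rw [e]
    refine (abs_add_le _ _).trans (add_le_add (hdiff.trans ?_) ?_)
    · have : 0 ≤ Real.exp M * (2 * K / A) := by positivity
      nlinarith
    · rw [abs_mul, abs_of_pos (Real.exp_pos _)]
      exact mul_le_mul hvξ (hBle ξ (hsub ξ (Ioo_subset_Icc_self hξ))) (Real.exp_pos _).le (by positivity)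
  have h2 : |v x| = |v x * Real.exp (B x)| * Real.exp (-B x) := by
    rw [abs_mul, abs_of_pos (Real.exp_pos _), mul_assoc, ← Real.exp_add]
    simp
  have h3 : Real.exp (-B x) ≤ Real.exp M := Real.exp_le_exp.2
    ((neg_le_abs _).trans (hM x (hsub x (left_mem_Icc.2 (by linarith)))))
  rw [h2]
  calc _ ≤ (Real.exp M * (2 * K / A) + 2 * K * Real.exp M) * Real.exp M :=
        mul_le_mul h1 h3 (Real.exp_pos _).le (by positivity)
    _ = _ := by ring

/-- The function `ψ` is the generator applied to `φ`. -/
def GenRel (A : ℝ) (b : ℝ → ℝ) (φ ψ : ℝ → ℝ) : Prop :=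
  ∃ v w : ℝ → ℝ, (∀ x, HasDerivAt φ (v x) x) ∧ (∀ x, HasDerivAt v (w x) x) ∧
    ∀ x, ψ x = A * w x + b x * v x

theorem line_solution {A : ℝ} {b : ℝ → ℝ} (hA : 0 < A) (hb : Continuous b)
    (hC : ∀ l, 0 < l → ∃ C, ∀ x, 2 * A + 2 * x * b x - l * x ^ 2 ≤ C)
    (g g1 g2 : BoundedContinuousFunction ℝ ℝ) (h1 : GenRel A b g g1) (h2 : GenRel A b g1 g2) :
    ∃ (S c : ℝ → BoundedContinuousFunction ℝ ℝ) (V : ℝ → ℝ → ℝ), Continuous S ∧ c 0 = 0 ∧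
      (∀ τ, HasDerivAt c (S τ) τ) ∧
      (∀ τ, 0 ≤ τ → ∀ x, HasDerivAt (c τ) (V τ x) x ∧
        HasDerivAt (V τ) ((S τ x - g x - b x * V τ x) / A) x) ∧
      ContinuousOn (fun z : ℝ × ℝ => V z.1 z.2) (Ici 0 ×ˢ univ) := by
  obtain ⟨R, hR⟩ := exists_resolvent_op hA hb hC
  have hgen : ∀ φ ψ : BoundedContinuousFunction ℝ ℝ, GenRel A b φ ψ → ∀ n, 0 < n →
      R n (n • φ - ψ) = φ := by
    rintro φ ψ ⟨v, w, hv, hw, hψ⟩ n hn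
    rw [← (hR n hn).2]
    refine ⟨v, hv, fun x => (hw x).congr_deriv ?_⟩
    simp only [BoundedContinuousFunction.coe_sub, BoundedContinuousFunction.coe_smul, Pi.sub_apply,
      smul_eq_mul, hψ x]
    field_simp
    ring
  obtain ⟨S, hS, hSR⟩ := hille_yosida R (fun l hl => (hR l hl).1) (by
    intro l m hl hm f
    rw [← (hR m hm).2]
    obtain ⟨v, hv⟩ := ((hR l hl).2 f _).2 rfl
    refine ⟨v, hv.1, fun x => (hv.2 x).congr_deriv ?_⟩
    simp only [BoundedContinuousFunction.coe_add, BoundedContinuousFunction.coe_smul, Pi.add_apply,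
      smul_eq_mul]
    ring) g g1 g2 (hgen g g1 h1) (hgen g1 g2 h2)
  set c : ℝ → BoundedContinuousFunction ℝ ℝ := fun τ => ∫ s in (0:ℝ)..τ, S s with hc
  have hcd : ∀ τ, HasDerivAt c (S τ) τ := fun τ => (hS.integral_hasStrictDerivAt 0 τ).hasDerivAt
  have hcc : Continuous c := continuous_iff_continuousAt.2 fun x => (hcd x).continuousAt
  have hV : ∀ τ, ∃ V, 0 ≤ τ → IsResSol A b 1 (c τ - S τ + g : BoundedContinuousFunction ℝ ℝ) (c τ) V := by
    intro τ
    by_cases hτ : 0 ≤ τ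
    · obtain ⟨V, hV⟩ := ((hR 1 one_pos).2 _ _).2 (hSR τ hτ)
      exact ⟨V, fun _ => hV⟩
    · exact ⟨0, fun h => absurd h hτ⟩
  choose V hV using hV
  refine ⟨S, c, V, hS, by simp [hc], hcd, fun τ hτ x => ⟨(hV τ hτ).1 x, ((hV τ hτ).2 x).congr_deriv ?_⟩, ?_⟩
  · simp; ring
  · rintro ⟨τ0, x0⟩ ⟨hτ0 : 0 ≤ τ0, -⟩
    obtain ⟨C, hC0, hCb⟩ := gradient_bound hA hb (|x0| + 1)
    set W : ℝ → BoundedContinuousFunction ℝ ℝ := fun τ => c τ - S τ + g with hW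
    have hWc : Continuous W := by fun_prop
    set F := nhdsWithin ((τ0, x0) : ℝ × ℝ) (Ici 0 ×ˢ univ)
    have hFle : F ≤ nhds (τ0, x0) := nhdsWithin_le_nhds
    have t1 : Tendsto (fun z : ℝ × ℝ => V τ0 z.2) F (nhds (V τ0 x0)) := by
      have : ContinuousAt (V τ0) x0 := ((hV τ0 hτ0).2 x0).continuousAt
      exact (this.tendsto.comp (continuous_snd.tendsto ((τ0, x0) : ℝ × ℝ))).mono_left hFle
    have t2 : Tendsto (fun z : ℝ × ℝ => V z.1 z.2 - V τ0 z.2) F (nhds 0) := by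
      have t3 : Tendsto (fun z : ℝ × ℝ => C * ‖W z.1 - W τ0‖) F (nhds 0) := by
        have : Continuous fun z : ℝ × ℝ => C * ‖W z.1 - W τ0‖ := by fun_prop
        have := (this.tendsto (τ0, x0)).mono_left hFle
        simpa using this
      refine squeeze_zero_norm' ?_ t3
      have ev1 : ∀ᶠ z in F, z ∈ (Ici 0 ×ˢ univ : Set (ℝ × ℝ)) := self_mem_nhdsWithin
      have ev2 : ∀ᶠ z : ℝ × ℝ in F, |z.2| < |x0| + 1 := by
        have : Continuous fun z : ℝ × ℝ => |z.2| := by fun_prop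
        exact ((this.tendsto (τ0, x0)).mono_left hFle).eventually (gt_mem_nhds (by simp))
      filter_upwards [ev1, ev2] with z hz1 hz2
      have hz : 0 ≤ z.1 := hz1.1
      have hl := (hV z.1 hz).lin 1 (-1) (hV τ0 hτ0)
      have hn : ‖c z.1 - c τ0‖ ≤ ‖W z.1 - W τ0‖ := by
        have e : R 1 (W z.1 - W τ0) = c z.1 - c τ0 := by
          rw [map_sub]
          exact congrArg₂ _ (hSR _ hz) (hSR _ hτ0)
        rw [← e]
        refine ((R 1).le_opNorm _).trans ?_
        have := (hR 1 one_pos).1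
        rw [div_one] at this
        nlinarith [norm_nonneg (W z.1 - W τ0)]
      have := hCb _ _ _ ‖W z.1 - W τ0‖ hl (fun x => by
        have := (W z.1 - W τ0).norm_coe_le_norm x
        rw [Real.norm_eq_abs] at this
        convert this using 2
        simp [hW]; ring) (fun x => by
        have := ((c z.1 - c τ0).norm_coe_le_norm x).trans hn
        rw [Real.norm_eq_abs] at this
        refine le_of_eq_of_le (congrArg _ ?_) this
        simp; ring) z.2 hz2.le
      rw [Real.norm_eq_abs]
      convert this using 2
      ring
    have := t2.add t1
    simpa [ContinuousWithinAt] using this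


theorem drift_lyap {A m q1 q2 : ℝ} (hq1 : 0 ≤ q1) (hq2 : 0 ≤ q2) (l : ℝ) (hl : 0 < l) :
    ∃ C, ∀ x, 2 * A + 2 * x * (m + q2 * Real.exp (-x) - q1 * Real.exp x) - l * x ^ 2 ≤ C := by
  refine ⟨2 * A + m ^ 2 / l + 2 * q1 + 2 * q2, fun x => ?_⟩
  have e1 : x * Real.exp (-x) ≤ 1 := by
    have h := Real.add_one_le_exp x
    have h2 : x ≤ Real.exp x := by linarith
    calc x * Real.exp (-x) ≤ Real.exp x * Real.exp (-x) :=
          mul_le_mul_of_nonneg_right h2 (Real.exp_pos _).le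
      _ = 1 := by rw [← Real.exp_add]; simp
  have e2 : -x * Real.exp x ≤ 1 := by
    have h := Real.add_one_le_exp (-x)
    have h2 : -x ≤ Real.exp (-x) := by linarith
    calc -x * Real.exp x ≤ Real.exp (-x) * Real.exp x :=
          mul_le_mul_of_nonneg_right h2 (Real.exp_pos _).le
      _ = 1 := by rw [← Real.exp_add]; simp
  have e3 : 2 * m * x - l * x ^ 2 ≤ m ^ 2 / l := by
    rw [le_div_iff₀ hl]
    nlinarith [sq_nonneg (l * x - m)]
  have f1 := mul_le_mul_of_nonneg_left e1 hq2
  have f2 := mul_le_mul_of_nonneg_left e2 hq1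
  nlinarith

noncomputable def polySig (P : Polynomial ℝ) : BoundedContinuousFunction ℝ ℝ :=
  BoundedContinuousFunction.ofNormedAddCommGroup (fun x => P.eval (Real.sigmoid x))
    (P.continuous.comp continuous_sigmoid)
    (Classical.choose (isCompact_Icc.exists_bound_of_continuousOn
      (s := Icc (0 : ℝ) 1) P.continuous.continuousOn))
    (fun x => Classical.choose_spec (isCompact_Icc.exists_bound_of_continuousOn
      (s := Icc (0 : ℝ) 1) P.continuous.continuousOn) _
        ⟨(Real.sigmoid_pos x).le, (Real.sigmoid_lt_one x).le⟩)

theorem polySig_apply (P : Polynomial ℝ) (x : ℝ) : polySig P x = P.eval (Real.sigmoid x) := rfl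

theorem exp_neg_sig (x : ℝ) :
    Real.exp (-x) * Real.sigmoid x = 1 - Real.sigmoid x := by
  have h := Real.exp_pos (-x)
  rw [Real.sigmoid_def]
  field_simp
  ring

theorem exp_sig (x : ℝ) :
    Real.exp x * (1 - Real.sigmoid x) = Real.sigmoid x := by
  have h := exp_neg_sig x
  rw [← h, ← mul_assoc, ← Real.exp_add]; simp

open Polynomial in
noncomputable def polyGen (A m q1 q2 : ℝ) (P : Polynomial ℝ) : Polynomial ℝ :=
  C A * (X * (1 - X)) ^ 2 * derivative (derivative P)
   + (C A * (1 - 2 * X) * (X * (1 - X)) + C m * (X * (1 - X)) + C q2 * (1 - X) ^ 2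
      - C q1 * X ^ 2) * derivative P

theorem polySig_gen (A m q1 q2 : ℝ) (P : Polynomial ℝ) :
    GenRel A (fun x => m + q2 * Real.exp (-x) - q1 * Real.exp x) (polySig P)
      (polySig (polyGen A m q1 q2 P)) := by
  have hs := Real.hasDerivAt_sigmoid
  refine ⟨fun x => P.derivative.eval (Real.sigmoid x) * (Real.sigmoid x * (1 - Real.sigmoid x)),
    fun x => P.derivative.derivative.eval (Real.sigmoid x)
        * (Real.sigmoid x * (1 - Real.sigmoid x)) * (Real.sigmoid x * (1 - Real.sigmoid x))
      + P.derivative.eval (Real.sigmoid x) *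
        ((1 - 2 * Real.sigmoid x) * (Real.sigmoid x * (1 - Real.sigmoid x))), ?_, ?_, ?_⟩
  · intro x
    exact (P.hasDerivAt (Real.sigmoid x)).comp x (hs x)
  · intro x
    have h1 := (P.derivative.hasDerivAt (Real.sigmoid x)).comp x (hs x)
    have h2 := (hs x).fun_mul ((hs x).const_sub 1)
    refine (HasDerivAt.fun_mul h1 h2).congr_deriv ?_
    simp only [Function.comp]
    ring
  · intro x
    have h1 := exp_neg_sig x
    have h2 := exp_sig x
    rw [polySig_apply]
    simp only [polyGen, Polynomial.eval_add, Polynomial.eval_sub, Polynomial.eval_mul,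
      Polynomial.eval_pow, Polynomial.eval_C, Polynomial.eval_X, Polynomial.eval_one,
      Polynomial.eval_ofNat]
    set p := Real.sigmoid x
    linear_combination (-P.derivative.eval p * q2 * (1 - p)) * h1
      + (P.derivative.eval p * q1 * p) * h2

theorem parab_max {T K M : ℝ} {a s : ℝ → ℝ} {w wt wp wpp : ℝ → ℝ → ℝ} (hK : 0 ≤ K)
    (hs : ∀ p ∈ Ioo (0 : ℝ) 1, 0 ≤ s p)
    (hV : ∀ p ∈ Ioo (0 : ℝ) 1,
      a p * (-p⁻¹ + (1 - p)⁻¹) + s p * ((p ^ 2)⁻¹ + ((1 - p) ^ 2)⁻¹) ≤ K)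
    (hd : ∀ t ∈ Ico (0 : ℝ) T, ∀ p ∈ Ioo (0 : ℝ) 1,
      HasDerivWithinAt (fun s => w s p) (wt t p) (Ico (0 : ℝ) T) t ∧
      HasDerivAt (fun q => w t q) (wp t p) p ∧
      HasDerivAt (fun q => wp t q) (wpp t p) p)
    (hc : ContinuousOn (fun z : ℝ × ℝ => w z.1 z.2) (Icc (0 : ℝ) T ×ˢ Ioo (0 : ℝ) 1))
    (hM : ∀ t ∈ Icc (0 : ℝ) T, ∀ p ∈ Ioo (0 : ℝ) 1, w t p ≤ M)
    (hterm : ∀ p ∈ Ioo (0 : ℝ) 1, w T p ≤ 0)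
    (hpde : ∀ t ∈ Ico (0 : ℝ) T, ∀ p ∈ Ioo (0 : ℝ) 1,
      0 ≤ wt t p + a p * wp t p + s p * wpp t p) :
    ∀ t ∈ Icc (0 : ℝ) T, ∀ p ∈ Ioo (0 : ℝ) 1, w t p ≤ 0 := by
  intro t1 ht1 p1 hp1
  by_contra hneg
  have hw1 : 0 < w t1 p1 := not_le.mp hneg
  set Vf : ℝ → ℝ := fun p => -Real.log p - Real.log (1 - p) with hVf
  have hlog : ∀ p ∈ Ioo (0 : ℝ) 1, Real.log p < 0 ∧ Real.log (1 - p) < 0 := fun p hp =>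
    ⟨Real.log_neg hp.1 hp.2, Real.log_neg (by linarith [hp.2]) (by linarith [hp.1])⟩
  have hT0 : 0 ≤ T := ht1.1.trans ht1.2
  have hV1 : 0 < Vf p1 := by have := hlog p1 hp1; simp only [hVf]; linarith
  set B := Vf p1 + (K + 1) * T with hB
  have hBpos : 0 < B := by positivity
  set ε := w t1 p1 / (2 * B) with hε
  have hεpos : 0 < ε := by positivity
  have hεB : ε * B = w t1 p1 / 2 := by rw [hε]; field_simp
  set z : ℝ → ℝ → ℝ := fun t p => w t p - ε * (Vf p + (K + 1) * (T - t)) with hz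
  have hz1 : 0 < z t1 p1 := by
    have h3 : (K + 1) * (T - t1) ≤ (K + 1) * T := by
      apply mul_le_mul_of_nonneg_left _ (by linarith)
      linarith [ht1.1]
    have h4 : ε * (Vf p1 + (K + 1) * (T - t1)) ≤ ε * B :=
      mul_le_mul_of_nonneg_left (by rw [hB]; linarith) hεpos.le
    simp only [hz]; linarith
  set δ := Real.exp (-(M / ε)) with hδ
  have hδpos : 0 < δ := Real.exp_pos _
  have hin : ∀ t ∈ Icc (0 : ℝ) T, ∀ p ∈ Ioo (0 : ℝ) 1, 0 < z t p → δ < p ∧ p < 1 - δ := by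
    intro t ht p hp hzp
    have hl := hlog p hp
    have hM' := hM t ht p hp
    have h5 : 0 ≤ ε * ((K + 1) * (T - t)) :=
      mul_nonneg hεpos.le (mul_nonneg (by linarith) (by linarith [ht.2]))
    simp only [hz, hVf] at hzp
    have h6 : 0 < ε * (-Real.log p) := mul_pos hεpos (by linarith)
    have h7 : 0 < ε * (-Real.log (1 - p)) := mul_pos hεpos (by linarith)
    have hMe : M = M / ε * ε := by field_simp
    have h8 : -(M / ε) < Real.log p := by
      by_contra hcon
      have := mul_le_mul_of_nonneg_left (not_lt.mp hcon) hεpos.le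
      nlinarith
    have h9 : -(M / ε) < Real.log (1 - p) := by
      by_contra hcon
      have := mul_le_mul_of_nonneg_left (not_lt.mp hcon) hεpos.le
      nlinarith
    have h10 := (Real.lt_log_iff_exp_lt hp.1).mp h8
    have h11 := (Real.lt_log_iff_exp_lt (by linarith [hp.2] : (0 : ℝ) < 1 - p)).mp h9
    exact ⟨h10, by rw [hδ]; linarith⟩
  have h12 := hin t1 ht1 p1 hp1 hz1
  have hsub : Icc (0 : ℝ) T ×ˢ Icc δ (1 - δ) ⊆ Icc (0 : ℝ) T ×ˢ Ioo (0 : ℝ) 1 := by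
    rintro ⟨t, p⟩ ⟨ht, hp⟩
    exact ⟨ht, hδpos.trans_le hp.1, lt_of_le_of_lt hp.2 (by linarith)⟩
  have hVc : ContinuousOn (fun y : ℝ × ℝ => Vf y.2) (Icc (0 : ℝ) T ×ˢ Ioo (0 : ℝ) 1) := by
    simp only [hVf]
    refine ContinuousOn.sub (ContinuousOn.neg (ContinuousOn.log continuousOn_snd ?_))
      (ContinuousOn.log (continuousOn_const.sub continuousOn_snd) ?_)
    · rintro ⟨t, p⟩ ⟨ht, hp⟩; exact hp.1.ne'
    · rintro ⟨t, p⟩ ⟨ht, hp⟩; exact (sub_pos.mpr hp.2).ne'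
  have hzc : ContinuousOn (fun y : ℝ × ℝ => z y.1 y.2) (Icc (0 : ℝ) T ×ˢ Icc δ (1 - δ)) := by
    refine ContinuousOn.mono ?_ hsub
    simp only [hz]
    refine hc.sub (continuousOn_const.mul (hVc.add ?_))
    fun_prop
  obtain ⟨⟨t0, p0⟩, ⟨ht0, hp0⟩, hmax⟩ := (isCompact_Icc.prod isCompact_Icc).exists_isMaxOn
    ⟨(t1, p1), ht1, h12.1.le, h12.2.le⟩ hzc
  simp only at ht0 hp0
  have hz0 : 0 < z t0 p0 :=
    hz1.trans_le (hmax (show (t1, p1) ∈ _ from ⟨ht1, h12.1.le, h12.2.le⟩))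
  have hp0' : p0 ∈ Ioo (0 : ℝ) 1 := (hsub (show (t0, p0) ∈ _ from ⟨ht0, hp0⟩)).2
  have hp00 := hin t0 ht0 p0 hp0' hz0
  have ht0T : t0 < T := by
    rcases lt_or_eq_of_le ht0.2 with h | h
    · exact h
    · exfalso
      have h13 := hterm p0 hp0'
      have h14 := hlog p0 hp0'
      have h15 : 0 < ε * Vf p0 := mul_pos hεpos (by simp only [hVf]; linarith)
      rw [h] at hz0
      simp only [hz, sub_self, mul_zero, add_zero] at hz0
      linarith
  have ht0' : t0 ∈ Ico (0 : ℝ) T := ⟨ht0.1, ht0T⟩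
  -- space
  have hspace : wp t0 p0 - ε * (-p0⁻¹ + (1 - p0)⁻¹) = 0 ∧
      wpp t0 p0 - ε * ((p0 ^ 2)⁻¹ + ((1 - p0) ^ 2)⁻¹) ≤ 0 := by
    refine second_deriv_nonpos (u := fun p => z t0 p)
      (v := fun p => wp t0 p - ε * (-p⁻¹ + (1 - p)⁻¹)) ?_ ?_ ?_
    · filter_upwards [isOpen_Ioo.mem_nhds hp0'] with p hp
      have hA := (hd t0 ht0' p hp).2.1
      have hL1 := Real.hasDerivAt_log hp.1.ne'
      have hL2 := ((hasDerivAt_id p).const_sub 1).log (sub_pos.mpr hp.2).ne'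
      have hVd : HasDerivAt Vf (-p⁻¹ + (1 - p)⁻¹) p := by
        refine (hL1.fun_neg.fun_sub hL2).congr_deriv ?_
        simp only [id]
        ring
      exact hA.fun_sub ((hVd.add_const _).const_mul ε)
    · have hA := (hd t0 ht0' p0 hp0').2.2
      have hL1 := hasDerivAt_inv hp0'.1.ne'
      have hL2 := ((hasDerivAt_id p0).const_sub 1).fun_inv (sub_pos.mpr hp0'.2).ne'
      refine hA.fun_sub (((hL1.fun_neg.fun_add hL2).const_mul ε).congr_deriv ?_)
      simp only [id]
      ring
    · filter_upwards [isOpen_Ioo.mem_nhds hp00] with p hp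
      exact hmax (show (t0, p) ∈ _ from ⟨ht0, hp.1.le, hp.2.le⟩)
  -- time
  have htime : wt t0 p0 + ε * (K + 1) ≤ 0 := by
    have hA := (hd t0 ht0' p0 hp0').1
    have hB1 : HasDerivWithinAt (fun t => z t p0) (wt t0 p0 + ε * (K + 1)) (Ico 0 T) t0 := by
      have hL : HasDerivWithinAt (fun t : ℝ => ε * (Vf p0 + (K + 1) * (T - t)))
          (-(ε * (K + 1))) (Ico 0 T) t0 := by
        refine ((((((hasDerivAt_id t0).const_sub T).const_mul (K + 1)).const_add
          (Vf p0)).const_mul ε).congr_deriv ?_).hasDerivWithinAt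
        ring
      exact (hA.fun_sub hL).congr_deriv (by ring)
    have hmx : IsLocalMaxOn (fun t => z t p0) (Ico 0 T) t0 := by
      filter_upwards [self_mem_nhdsWithin] with t ht
      exact hmax (show (t, p0) ∈ _ from ⟨⟨ht.1, ht.2.le⟩, hp0⟩)
    have hseg : segment ℝ t0 (t0 + (T - t0) / 2) ⊆ Ico 0 T := by
      rw [segment_eq_Icc (by linarith)]
      intro t ht
      exact ⟨ht0.1.trans ht.1, lt_of_le_of_lt ht.2 (by linarith)⟩
    have := hmx.hasFDerivWithinAt_nonpos hB1.hasFDerivWithinAt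
      (mem_posTangentConeAt_of_segment_subset hseg)
    simp at this
    have hTt : 0 < T - t0 := by linarith
    by_contra hcon
    have := mul_pos hTt (not_le.mp hcon)
    linarith
  have hP := hpde t0 ht0' p0 hp0'
  have hV0 := mul_le_mul_of_nonneg_left (hV p0 hp0') hεpos.le
  have hS := mul_le_mul_of_nonneg_left hspace.2 (hs p0 hp0')
  have hwp : wp t0 p0 = ε * (-p0⁻¹ + (1 - p0)⁻¹) := by linarith [hspace.1]
  rw [hwp] at hP
  nlinarith


theorem lyap_p {k m0 q1 q2 : ℝ} (hk : 0 < k) (hq1 : 0 ≤ q1) (hq2 : 0 ≤ q2) :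
    ∀ p ∈ Ioo (0 : ℝ) 1,
      ((q2 * (1 - p) - q1 * p) - k * (p * (1 - p)) * (k * p + m0)) * (-p⁻¹ + (1 - p)⁻¹)
        + (k * (p * (1 - p))) ^ 2 / 2 * ((p ^ 2)⁻¹ + ((1 - p) ^ 2)⁻¹)
        ≤ q1 + q2 + k * (k + |m0|) + k ^ 2 := by
  intro p hp
  have hp1 : 0 < p := hp.1
  have hp2 : 0 < 1 - p := sub_pos.mpr hp.2
  have e : ((q2 * (1 - p) - q1 * p) - k * (p * (1 - p)) * (k * p + m0)) * (-p⁻¹ + (1 - p)⁻¹)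
        + (k * (p * (1 - p))) ^ 2 / 2 * ((p ^ 2)⁻¹ + ((1 - p) ^ 2)⁻¹)
      = q2 * (2 - p⁻¹) + q1 * (2 - (1 - p)⁻¹) + k * ((k * p + m0) * (1 - 2 * p))
        + k ^ 2 * (((1 - p) ^ 2 + p ^ 2) / 2) := by
    field_simp
    ring
  rw [e]
  have i1 : 1 ≤ p⁻¹ := (one_le_inv₀ hp1).mpr hp.2.le
  have i2 : 1 ≤ (1 - p)⁻¹ := (one_le_inv₀ hp2).mpr (by linarith)
  have f1 : q2 * (2 - p⁻¹) ≤ q2 * 1 := mul_le_mul_of_nonneg_left (by linarith) hq2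
  have f2 : q1 * (2 - (1 - p)⁻¹) ≤ q1 * 1 := mul_le_mul_of_nonneg_left (by linarith) hq1
  have f3 : (k * p + m0) * (1 - 2 * p) ≤ k + |m0| := by
    have g1 : |k * p + m0| ≤ k + |m0| := by
      refine (abs_add_le _ _).trans ?_
      rw [abs_of_pos (mul_pos hk hp1)]
      nlinarith
    have g2 : |1 - 2 * p| ≤ 1 := abs_le.mpr ⟨by linarith [hp.2], by linarith⟩
    calc (k * p + m0) * (1 - 2 * p) ≤ |(k * p + m0) * (1 - 2 * p)| := le_abs_self _
      _ = |k * p + m0| * |1 - 2 * p| := abs_mul _ _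
      _ ≤ (k + |m0|) * 1 := mul_le_mul g1 g2 (abs_nonneg _) (by positivity)
      _ = _ := mul_one _
  have f4 := mul_le_mul_of_nonneg_left f3 hk.le
  have f5 : k ^ 2 * (((1 - p) ^ 2 + p ^ 2) / 2) ≤ k ^ 2 * 1 := by
    apply mul_le_mul_of_nonneg_left _ (by positivity)
    nlinarith
  linarith

noncomputable def logitFn (p : ℝ) : ℝ := Real.log p - Real.log (1 - p)

theorem logitFn_deriv {p : ℝ} (hp : p ∈ Ioo (0 : ℝ) 1) :
    HasDerivAt logitFn (p⁻¹ + (1 - p)⁻¹) p := by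
  have hL1 := Real.hasDerivAt_log hp.1.ne'
  have hL2 := ((hasDerivAt_id p).const_sub 1).log (sub_pos.mpr hp.2).ne'
  refine (hL1.fun_sub hL2).congr_deriv ?_
  simp only [id]
  ring

theorem logitFn_deriv2 {p : ℝ} (hp : p ∈ Ioo (0 : ℝ) 1) :
    HasDerivAt (fun p : ℝ => p⁻¹ + (1 - p)⁻¹) (-(p ^ 2)⁻¹ + ((1 - p) ^ 2)⁻¹) p := by
  have hL1 := hasDerivAt_inv hp.1.ne'
  have hL2 := ((hasDerivAt_id p).const_sub 1).fun_inv (sub_pos.mpr hp.2).ne'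
  refine (hL1.fun_add hL2).congr_deriv ?_
  simp only [id]
  ring

theorem exp_logit {p : ℝ} (hp : p ∈ Ioo (0 : ℝ) 1) : Real.exp (logitFn p) = p / (1 - p) := by
  rw [logitFn, Real.exp_sub, Real.exp_log hp.1, Real.exp_log (sub_pos.mpr hp.2)]

theorem exp_neg_logit {p : ℝ} (hp : p ∈ Ioo (0 : ℝ) 1) :
    Real.exp (-logitFn p) = (1 - p) / p := by
  rw [Real.exp_neg, exp_logit hp, inv_div]

theorem sigmoid_logit {p : ℝ} (hp : p ∈ Ioo (0 : ℝ) 1) : Real.sigmoid (logitFn p) = p := by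
  have hp1 := hp.1
  rw [Real.sigmoid_def, exp_neg_logit hp]
  field_simp
  ring

theorem exist_p {T k m0 q1 q2 κ : ℝ} (hk : 0 < k) (hq1 : 0 ≤ q1) (hq2 : 0 ≤ q2) :
    ∃ c ct cp cpp : ℝ → ℝ → ℝ,
    (∀ t ∈ Ico (0 : ℝ) T, ∀ p ∈ Ioo (0 : ℝ) 1,
      HasDerivWithinAt (fun s => c s p) (ct t p) (Ico (0 : ℝ) T) t ∧
      HasDerivAt (fun q => c t q) (cp t p) p ∧
      HasDerivAt (fun q => cp t q) (cpp t p) p) ∧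
    ContinuousOn (fun z : ℝ × ℝ => ct z.1 z.2) (Ico (0 : ℝ) T ×ˢ Ioo (0 : ℝ) 1) ∧
    ContinuousOn (fun z : ℝ × ℝ => cp z.1 z.2) (Ico (0 : ℝ) T ×ˢ Ioo (0 : ℝ) 1) ∧
    ContinuousOn (fun z : ℝ × ℝ => cpp z.1 z.2) (Ico (0 : ℝ) T ×ˢ Ioo (0 : ℝ) 1) ∧
    ContinuousOn (fun z : ℝ × ℝ => c z.1 z.2) (Icc (0 : ℝ) T ×ˢ Ioo (0 : ℝ) 1) ∧
    (∀ t ∈ Ico (0 : ℝ) T, ∀ p ∈ Ioo (0 : ℝ) 1,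
      ct t p + ((q2 * (1 - p) - q1 * p) - k * (p * (1 - p)) * (k * p + m0)) * cp t p
        + (k * (p * (1 - p))) ^ 2 / 2 * cpp t p + κ * (k * p + m0) ^ 2 = 0) ∧
    (∀ p ∈ Ioo (0 : ℝ) 1, c T p = 0) ∧
    ∃ M : ℝ, ∀ t ∈ Icc (0 : ℝ) T, ∀ p ∈ Ioo (0 : ℝ) 1, |c t p| ≤ M := by
  set m := q2 - q1 - k * m0 - k ^ 2 / 2 with hm
  set A := k ^ 2 / 2 with hA
  have hApos : 0 < A := by positivity
  set b : ℝ → ℝ := fun x => m + q2 * Real.exp (-x) - q1 * Real.exp x with hb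
  have hbc : Continuous b := by simp only [hb]; fun_prop
  let P : Polynomial ℝ := Polynomial.C κ * (Polynomial.C k * Polynomial.X + Polynomial.C m0) ^ 2
  obtain ⟨S, C, V, hSc, hC0, hCd, hx, hVc⟩ := line_solution hApos hbc
    (fun l hl => drift_lyap hq1 hq2 l hl) (polySig P) (polySig (polyGen A m q1 q2 P))
    (polySig (polyGen A m q1 q2 (polyGen A m q1 q2 P)))
    (polySig_gen A m q1 q2 P) (polySig_gen A m q1 q2 _)
  have hCc : Continuous C := continuous_iff_continuousAt.mpr fun τ => (hCd τ).continuousAt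
  have hlc : ContinuousOn (fun z : ℝ × ℝ => logitFn z.2) (univ ×ˢ Ioo (0 : ℝ) 1) := by
    intro z hz
    exact ((logitFn_deriv hz.2).continuousAt.comp continuousAt_snd).continuousWithinAt
  have hl1c : ContinuousOn (fun z : ℝ × ℝ => z.2⁻¹ + (1 - z.2)⁻¹) (univ ×ˢ Ioo (0 : ℝ) 1) := by
    intro z hz
    exact ((logitFn_deriv2 hz.2).continuousAt.comp continuousAt_snd).continuousWithinAt
  have hl2c : ContinuousOn (fun z : ℝ × ℝ => -(z.2 ^ 2)⁻¹ + ((1 - z.2) ^ 2)⁻¹)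
      (univ ×ˢ Ioo (0 : ℝ) 1) := by
    refine ContinuousOn.add (ContinuousOn.neg (ContinuousOn.inv₀ (by fun_prop) ?_))
      (ContinuousOn.inv₀ (by fun_prop) ?_)
    · rintro z hz; exact pow_ne_zero _ hz.2.1.ne'
    · rintro z hz; exact pow_ne_zero _ (sub_pos.mpr hz.2.2).ne'
  have hsubI : Ico (0 : ℝ) T ×ˢ Ioo (0 : ℝ) 1 ⊆ univ ×ˢ Ioo (0 : ℝ) 1 :=
    prod_mono (subset_univ _) le_rfl
  have hsubC : Icc (0 : ℝ) T ×ˢ Ioo (0 : ℝ) 1 ⊆ univ ×ˢ Ioo (0 : ℝ) 1 :=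
    prod_mono (subset_univ _) le_rfl
  have hev : ∀ F : ℝ → BoundedContinuousFunction ℝ ℝ, Continuous F →
      ContinuousOn (fun z : ℝ × ℝ => F (T - z.1) (logitFn z.2)) (univ ×ˢ Ioo (0 : ℝ) 1) := by
    intro F hF
    have h1 : Continuous (fun z : ℝ × ℝ => F z.1 z.2) :=
      continuous_eval.comp ((hF.comp continuous_fst).prodMk continuous_snd)
    exact h1.comp_continuousOn ((continuous_const.sub continuous_fst).continuousOn.prodMk hlc)
  have hVev : ContinuousOn (fun z : ℝ × ℝ => V (T - z.1) (logitFn z.2))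
      (Ico (0 : ℝ) T ×ˢ Ioo (0 : ℝ) 1) := by
    refine hVc.comp ((continuous_const.sub continuous_fst).continuousOn.prodMk
      (hlc.mono hsubI)) ?_
    rintro z hz
    exact ⟨sub_nonneg.mpr hz.1.2.le, mem_univ _⟩
  have hbev : ContinuousOn (fun z : ℝ × ℝ => b (logitFn z.2)) (Ico (0 : ℝ) T ×ˢ Ioo (0 : ℝ) 1) :=
    hbc.comp_continuousOn (hlc.mono hsubI)
  have hgev : ContinuousOn (fun z : ℝ × ℝ => polySig P (logitFn z.2))
      (Ico (0 : ℝ) T ×ˢ Ioo (0 : ℝ) 1) :=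
    (polySig P).continuous.comp_continuousOn (hlc.mono hsubI)
  refine ⟨fun t p => C (T - t) (logitFn p), fun t p => -S (T - t) (logitFn p),
    fun t p => V (T - t) (logitFn p) * (p⁻¹ + (1 - p)⁻¹),
    fun t p => (S (T - t) (logitFn p) - polySig P (logitFn p)
        - b (logitFn p) * V (T - t) (logitFn p)) / A * (p⁻¹ + (1 - p)⁻¹) * (p⁻¹ + (1 - p)⁻¹)
      + V (T - t) (logitFn p) * (-(p ^ 2)⁻¹ + ((1 - p) ^ 2)⁻¹), ?_, ?_, ?_, ?_, ?_, ?_, ?_, ?_⟩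
  · intro t ht p hp
    have hτ : 0 ≤ T - t := sub_nonneg.mpr ht.2.le
    have hX := hx (T - t) hτ (logitFn p)
    refine ⟨?_, ?_, ?_⟩
    · have h1 := ((BoundedContinuousFunction.evalCLM ℝ (logitFn p)).hasFDerivAt.comp_hasDerivAt
        (T - t) (hCd (T - t)))
      have h2 := h1.scomp t ((hasDerivAt_id t).const_sub T)
      refine HasDerivAt.hasDerivWithinAt (h2.congr_deriv ?_)
      simp
    · exact hX.1.comp p (logitFn_deriv hp)
    · exact (hX.2.comp p (logitFn_deriv hp)).fun_mul (logitFn_deriv2 hp)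
  · exact ((hev S hSc).mono hsubI).neg
  · exact hVev.mul (hl1c.mono hsubI)
  · exact (((((((hev S hSc).mono hsubI).sub hgev).sub (hbev.mul hVev)).div_const A).mul
      (hl1c.mono hsubI)).mul (hl1c.mono hsubI)).add (hVev.mul (hl2c.mono hsubI))
  · exact (hev C hCc).mono hsubC
  · intro t ht p hp
    have hp1 := hp.1
    have hp2 : 0 < 1 - p := sub_pos.mpr hp.2
    have hP : polySig P (logitFn p) = κ * (k * p + m0) ^ 2 := by
      rw [polySig_apply, sigmoid_logit hp]; simp [P]
    have hbp : b (logitFn p) = m + q2 * ((1 - p) / p) - q1 * (p / (1 - p)) := by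
      simp only [hb]; rw [exp_logit hp, exp_neg_logit hp]
    simp only [hP, hbp]
    rw [hm, hA]
    field_simp
    ring
  · intro p hp
    simp [hC0]
  · obtain ⟨M, hM⟩ := isCompact_Icc.exists_bound_of_continuousOn
      (s := Icc (0 : ℝ) T) hCc.continuousOn
    refine ⟨M, fun t ht p hp => ?_⟩
    refine le_trans ?_ (hM (T - t) ⟨by linarith [ht.2], by linarith [ht.1]⟩)
    exact (C (T - t)).norm_coe_le_norm _

/-- Existence, a priori bounds, and uniqueness (in the class of bounded solutions)
for the first degenerate Cauchy problem. -/
theorem first_cauchy_problem_wellposed (T r σ μ₁ μ₂ κ : ℝ) (η : ℝ → ℝ)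
    (hT : 0 < T) (hσ : 0 < σ) (hμ : μ₂ < μ₁) (hκ : 0 < κ)
    (hη : AdmissibleFilterDrift η) :
    ∃ c : ℝ → ℝ → ℝ, SolvesFirstCauchy T r σ μ₁ μ₂ κ η c ∧
      (∀ t ∈ Icc (0 : ℝ) T, ∀ p ∈ Ioo (0 : ℝ) 1,
        0 ≤ c t p ∧
        c t p ≤ (T - t) * κ * max (((μ₁ - r) / σ) ^ 2) (((μ₂ - r) / σ) ^ 2)) ∧
      (∀ c' : ℝ → ℝ → ℝ, SolvesFirstCauchy T r σ μ₁ μ₂ κ η c' →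
        (∃ M : ℝ, ∀ t ∈ Icc (0 : ℝ) T, ∀ p ∈ Ioo (0 : ℝ) 1, |c' t p| ≤ M) →
        ∀ t ∈ Icc (0 : ℝ) T, ∀ p ∈ Ioo (0 : ℝ) 1, c' t p = c t p) := by
  obtain ⟨q1, q2, hq1, hq2, hηq⟩ : ∃ q1 q2 : ℝ, 0 ≤ q1 ∧ 0 ≤ q2 ∧
      ∀ p, η p = q2 * (1 - p) - q1 * p := by
    rcases hη with h | ⟨q1, q2, h1, h2, h⟩
    · exact ⟨0, 0, le_rfl, le_rfl, fun p => by rw [h]; ring⟩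
    · exact ⟨q1, q2, h1.le, h2.le, fun p => by rw [h]; ring⟩
  set k := (μ₁ - μ₂) / σ with hk
  set m0 := (μ₂ - r) / σ with hm0
  have hkpos : 0 < k := div_pos (sub_pos.mpr hμ) hσ
  have hf : ∀ p, (filterTheta μ₁ μ₂ p - r) / σ = k * p + m0 := by
    intro p; rw [filterTheta, hk, hm0]; ring
  have hβ : ∀ p, filterBeta μ₁ μ₂ σ p = k * (p * (1 - p)) := fun p => rfl
  have hf1 : (μ₁ - r) / σ = k + m0 := by rw [hk, hm0]; ring
  have hKnn : 0 ≤ q1 + q2 + k * (k + |m0|) + k ^ 2 := by positivity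
  have hs : ∀ p ∈ Ioo (0 : ℝ) 1, 0 ≤ (k * (p * (1 - p))) ^ 2 / 2 := fun p _ => by positivity
  have hV := lyap_p (m0 := m0) hkpos hq1 hq2
  obtain ⟨c, ct, cp, cpp, hd, hct, hcp, hcpp, hcc, hpde, hterm, M, hM⟩ :=
    exist_p (T := T) (m0 := m0) (κ := κ) hkpos hq1 hq2
  refine ⟨c, ⟨ct, cp, cpp, hd, hct, hcp, hcpp, hcc, ?_, hterm⟩, ?_, ?_⟩
  · intro t ht p hp
    rw [hηq, hβ, hf]
    exact hpde t ht p hp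
  · intro t ht p hp
    constructor
    · have h := parab_max (M := M) (w := fun t p => -c t p) (wt := fun t p => -ct t p)
        (wp := fun t p => -cp t p) (wpp := fun t p => -cpp t p) hKnn hs hV
        (fun t ht p hp => ⟨(hd t ht p hp).1.fun_neg, (hd t ht p hp).2.1.fun_neg,
          (hd t ht p hp).2.2.fun_neg⟩) hcc.neg
        (fun t ht p hp => (neg_le_abs _).trans (hM t ht p hp))
        (fun p hp => by simp [hterm p hp])
        (fun t ht p hp => by
          have h1 := hpde t ht p hp
          have h2 : 0 ≤ κ * (k * p + m0) ^ 2 := by positivity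
          linarith) t ht p hp
      linarith
    · set G := max (((μ₁ - r) / σ) ^ 2) (m0 ^ 2) with hG
      have hGnn : 0 ≤ G := (sq_nonneg _).trans (le_max_right _ _)
      have h := parab_max (M := M) (w := fun t p => c t p - (T - t) * κ * G)
        (wt := fun t p => ct t p + κ * G)
        (wp := cp) (wpp := cpp) hKnn hs hV
        (fun t ht p hp => ⟨by
            have hL : HasDerivAt (fun s : ℝ => (T - s) * κ * G) (-(κ * G)) t := by
              refine (((((hasDerivAt_id t).const_sub T).mul_const κ).mul_const G).congr_deriv ?_)
              ring
            exact ((hd t ht p hp).1.fun_sub hL.hasDerivWithinAt).congr_deriv (by ring),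
          (hd t ht p hp).2.1.sub_const _, (hd t ht p hp).2.2⟩)
        (hcc.sub (by fun_prop))
        (fun t ht p hp => by
          have h1 := (le_abs_self _).trans (hM t ht p hp)
          have h2 : 0 ≤ (T - t) * κ * G :=
            mul_nonneg (mul_nonneg (sub_nonneg.mpr ht.2) hκ.le) hGnn
          linarith)
        (fun p hp => by simp [hterm p hp])
        (fun t ht p hp => by
          have h1 := hpde t ht p hp
          have h2 : (k * p + m0) ^ 2 ≤ G := by
            have e1 : (k + m0) ^ 2 ≤ G := by rw [← hf1]; exact le_max_left _ _
            have e2 : m0 ^ 2 ≤ G := le_max_right _ _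
            have e3 := mul_le_mul_of_nonneg_left e1 hp.1.le
            have e4 := mul_le_mul_of_nonneg_left e2 (sub_nonneg.mpr hp.2.le)
            have e5 : 0 ≤ p * (1 - p) * k ^ 2 :=
              mul_nonneg (mul_nonneg hp.1.le (sub_nonneg.mpr hp.2.le)) (sq_nonneg _)
            nlinarith
          have h3 := mul_le_mul_of_nonneg_left h2 hκ.le
          linarith) t ht p hp
      linarith
  · rintro c' ⟨ct', cp', cpp', hd', -, -, -, hcc', hpde', hterm'⟩ ⟨M', hM'⟩ t ht p hp
    have hpde'' : ∀ t ∈ Ico (0 : ℝ) T, ∀ p ∈ Ioo (0 : ℝ) 1,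
        ct' t p + ((q2 * (1 - p) - q1 * p) - k * (p * (1 - p)) * (k * p + m0)) * cp' t p
        + (k * (p * (1 - p))) ^ 2 / 2 * cpp' t p + κ * (k * p + m0) ^ 2 = 0 := by
      intro t ht p hp
      have h := hpde' t ht p hp
      rw [hηq, hβ, hf] at h
      exact h
    have h1 := parab_max (M := M + M') (w := fun t p => c t p - c' t p)
      (wt := fun t p => ct t p - ct' t p)
      (wp := fun t p => cp t p - cp' t p) (wpp := fun t p => cpp t p - cpp' t p) hKnn hs hV
      (fun t ht p hp => ⟨(hd t ht p hp).1.fun_sub (hd' t ht p hp).1,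
        (hd t ht p hp).2.1.fun_sub (hd' t ht p hp).2.1,
        (hd t ht p hp).2.2.fun_sub (hd' t ht p hp).2.2⟩) (hcc.sub hcc')
      (fun t ht p hp => by
        have := abs_le.mp (hM t ht p hp)
        have := abs_le.mp (hM' t ht p hp)
        linarith)
      (fun p hp => by simp [hterm p hp, hterm' p hp])
      (fun t ht p hp => by linarith [hpde t ht p hp, hpde'' t ht p hp]) t ht p hp
    have h2 := parab_max (M := M + M') (w := fun t p => c' t p - c t p)
      (wt := fun t p => ct' t p - ct t p)
      (wp := fun t p => cp' t p - cp t p) (wpp := fun t p => cpp' t p - cpp t p) hKnn hs hV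
      (fun t ht p hp => ⟨(hd' t ht p hp).1.fun_sub (hd t ht p hp).1,
        (hd' t ht p hp).2.1.fun_sub (hd t ht p hp).2.1,
        (hd' t ht p hp).2.2.fun_sub (hd t ht p hp).2.2⟩) (hcc'.sub hcc)
      (fun t ht p hp => by
        have := abs_le.mp (hM t ht p hp)
        have := abs_le.mp (hM' t ht p hp)
        linarith)
      (fun p hp => by simp [hterm p hp, hterm' p hp])
      (fun t ht p hp => by linarith [hpde t ht p hp, hpde'' t ht p hp]) t ht p hp
    linarith
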